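/- Let Δ ≥ 7 be an integer and let G be a minimal counterexample to the bound χ'_s ≤ 3Δ for graphs with Mad ≤ 3, maximum degree at most Δ, and no 3-regular subgraph. Then for every vertex v of G*: (i) if Σ_{u ∈ N_{G*}(v)} d_G(u) ≤ 2Δ + d_{G*}(v), then d_G(v) = d_{G*}(v); (ii) d_{G*}(v) ≥ 2; (iii) if d_{G*}(v) = 2 then d_G(v) = 2; (iv) if d_{G*}(v) = 3 and v has a neighbor u in G* with d_G(u) ≤ 3, then d_G(v) = 3. -/

import Mathlib

open scoped Classical

namespace StrongEC

/-- Two edges of `G` conflict for strong edge-coloring: they are distinct and either share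
an endpoint or are both adjacent to a common edge of `G`. -/
def Conflict {V : Type*} (G : SimpleGraph V) (e e' : Sym2 V) : Prop :=
  e ≠ e' ∧ ((∃ v, v ∈ e ∧ v ∈ e') ∨
    ∃ f ∈ G.edgeSet, (∃ v, v ∈ e ∧ v ∈ f) ∧ (∃ w, w ∈ e' ∧ w ∈ f))

/-- `C` is a strong edge-coloring of `G` with `k` colors. -/
def IsStrongColoring {V : Type*} (G : SimpleGraph V) {k : ℕ} (C : Sym2 V → Fin k) : Prop :=
  ∀ e ∈ G.edgeSet, ∀ e' ∈ G.edgeSet, Conflict G e e' → C e ≠ C e'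

/-- `G` admits a strong `k`-edge-coloring. -/
def HasStrongColoring {V : Type*} (G : SimpleGraph V) (k : ℕ) : Prop :=
  ∃ C : Sym2 V → Fin k, IsStrongColoring G C

/-- The strong chromatic index of `G`: the least `k` such that `G` admits a strong
`k`-edge-coloring. -/
noncomputable def strongChromaticIndex {V : Type*} (G : SimpleGraph V) : ℕ :=
  sInf {k | HasStrongColoring G k}

/-- The maximum average degree of a finite graph `G`: the supremum over nonempty vertex
subsets `A` of `2 * e(A) / |A|`, where `e(A)` is the number of edges of `G` inside `A`
(this equals the maximum of `2|E(H)|/|V(H)|` over all subgraphs `H` with at least one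
vertex). -/
noncomputable def mad {V : Type*} (G : SimpleGraph V) : ℝ :=
  sSup {x : ℝ | ∃ A : Finset V, A.Nonempty ∧
    x = 2 * ({e ∈ G.edgeSet | ∀ v ∈ e, v ∈ A}.ncard : ℝ) / (A.card : ℝ)}

/-- `G` has a 3-regular subgraph: a subgraph on a nonempty vertex set all of whose
vertices have degree exactly 3 in it. -/
def Has3RegularSubgraph {V : Type*} (G : SimpleGraph V) : Prop :=
  ∃ H : SimpleGraph V, H ≤ G ∧ H.support.Nonempty ∧
    ∀ v ∈ H.support, (H.neighborSet v).ncard = 3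

/-- The graph `G*` obtained from `G` by deleting all vertices of degree 1 in `G`. -/
noncomputable def core {V : Type*} [Fintype V] (G : SimpleGraph V) : SimpleGraph V :=
  SimpleGraph.fromRel (fun u v => G.Adj u v ∧ G.degree u ≠ 1 ∧ G.degree v ≠ 1)

/-- The number of vertices of degree at least 2. -/
noncomputable def twoPlusCount {W : Type} [Fintype W] (H : SimpleGraph W) : ℕ :=
  (Finset.univ.filter (fun v : W => 2 ≤ H.degree v)).card

/-- A graph with maximum average degree at most `3`, maximum degree at most `Δ`, and no
3-regular subgraph. -/
def GoodB (Δ : ℕ) {W : Type} [Fintype W] (H : SimpleGraph W) : Prop :=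
  mad H ≤ 3 ∧ H.maxDegree ≤ Δ ∧ ¬ Has3RegularSubgraph H

/-- `G` is a minimal counterexample to the bound `χ'_s ≤ 3Δ` for graphs with `Mad ≤ 3`,
maximum degree at most `Δ` and no 3-regular subgraph. -/
def MinCexB (Δ : ℕ) {V : Type} [Fintype V] (G : SimpleGraph V) : Prop :=
  GoodB Δ G ∧ ¬ HasStrongColoring G (3 * Δ) ∧
    ∀ (W : Type) [Fintype W] (H : SimpleGraph W), GoodB Δ H →
      (twoPlusCount H < twoPlusCount G ∨
        (twoPlusCount H = twoPlusCount G ∧ H.edgeSet.ncard < G.edgeSet.ncard)) →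
      HasStrongColoring H (3 * Δ)

section
variable {V : Type} [Fintype V]

noncomputable def nb (G : SimpleGraph V) (v : V) : Finset V :=
  Finset.univ.filter (fun w => G.Adj v w)

noncomputable def dg (G : SimpleGraph V) (v : V) : ℕ := (nb G v).card

noncomputable def cl (G : SimpleGraph V) (K : Finset (Sym2 V)) (v : V) : ℕ :=
  ((nb G v).filter (fun w => s(v, w) ∈ K)).card

noncomputable def XX (G : SimpleGraph V) (K : Finset (Sym2 V)) (v : V) : ℕ :=
  ∑ u ∈ nb G v, cl G K u

/-- core neighbours -/
noncomputable def cn (G : SimpleGraph V) (v : V) : Finset V :=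
  (nb G v).filter (fun w => 2 ≤ dg G w)

noncomputable def dd (G : SimpleGraph V) (v : V) : ℕ := (cn G v).card

noncomputable def ll (G : SimpleGraph V) (v : V) : ℕ :=
  ((nb G v).filter (fun w => dg G w = 1)).card

structure Ctx (Δ : ℕ) (G : SimpleGraph V) (K : Finset (Sym2 V)) : Prop where
  hD : 7 ≤ Δ
  hdeg : ∀ v, dg G v ≤ Δ
  F1 : ∀ u v, s(u, v) ∈ K → 3 * Δ + cl G K u + cl G K v ≤ XX G K u + XX G K v
  F2 : ∀ u w, G.Adj u w → 1 ≤ cl G K u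

variable {G : SimpleGraph V} {K : Finset (Sym2 V)} {Δ : ℕ}

lemma mem_nb {v w : V} : w ∈ nb G v ↔ G.Adj v w := by simp [nb]

lemma cl_le_dg (v : V) : cl G K v ≤ dg G v := Finset.card_filter_le _ _

lemma cl_le (h : Ctx Δ G K) (v : V) : cl G K v ≤ Δ := (cl_le_dg v).trans (h.hdeg v)

lemma dg_pos {v w : V} (a : G.Adj v w) : 1 ≤ dg G w :=
  Finset.card_pos.2 ⟨v, mem_nb.2 a.symm⟩

lemma cl_sum (v : V) : cl G K v = ∑ w ∈ nb G v, if s(v, w) ∈ K then 1 else 0 := by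
  rw [cl, Finset.card_filter]

lemma cl_succ_le {v w : V} (a : G.Adj v w) (hk : s(v, w) ∉ K) : cl G K v + 1 ≤ dg G v := by
  have : (nb G v).filter (fun w => s(v, w) ∈ K) ⊂ nb G v :=
    Finset.filter_ssubset.2 ⟨w, mem_nb.2 a, hk⟩
  exact Finset.card_lt_card this

lemma dg_eq (v : V) : dg G v = dd G v + ll G v := by
  unfold dg dd ll cn
  rw [Finset.card_filter, Finset.card_filter, ← Finset.sum_add_distrib, Finset.card_eq_sum_ones]
  refine Finset.sum_congr rfl fun u hu => ?_
  have := dg_pos (mem_nb.1 hu)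
  split_ifs <;> omega

lemma one_nb {v w : V} (a : G.Adj v w) (h1 : dg G v = 1) : nb G v = {w} := by
  obtain ⟨x, hx⟩ := Finset.card_eq_one.1 h1
  have : w ∈ nb G v := mem_nb.2 a
  rw [hx] at this ⊢
  rw [Finset.mem_singleton.1 this]

lemma two_nb {v w : V} (a : G.Adj v w) (h2 : dg G v = 2) :
    ∃ x, x ≠ w ∧ G.Adj v x ∧ nb G v = {w, x} := by
  have hw : w ∈ nb G v := mem_nb.2 a
  have h1 : ((nb G v).erase w).card = 1 := by
    rw [Finset.card_erase_of_mem hw]; unfold dg at h2; omega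
  obtain ⟨x, hx⟩ := Finset.card_eq_one.1 h1
  have hx' : x ∈ (nb G v).erase w := by simp [hx]
  refine ⟨x, Finset.ne_of_mem_erase hx', mem_nb.1 (Finset.mem_of_mem_erase hx'), ?_⟩
  rw [← Finset.insert_erase hw, hx]

lemma two_nb' {v w x : V} (a : G.Adj v w) (b : G.Adj v x) (hne : x ≠ w) (h2 : dg G v = 2) :
    nb G v = {w, x} := by
  obtain ⟨y, hy, _, e⟩ := two_nb a h2
  have : x ∈ nb G v := mem_nb.2 b
  rw [e] at this ⊢
  simp at this
  rcases this with rfl | rfl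
  · exact absurd rfl hne
  · rfl

lemma three_nb {v w x : V} (a : G.Adj v w) (b : G.Adj v x) (hne : x ≠ w) (h3 : dg G v = 3) :
    ∃ y, y ≠ w ∧ y ≠ x ∧ G.Adj v y ∧ nb G v = {w, x, y} := by
  have hw : w ∈ nb G v := mem_nb.2 a
  have hx : x ∈ (nb G v).erase w := Finset.mem_erase.2 ⟨hne, mem_nb.2 b⟩
  have h1 : (((nb G v).erase w).erase x).card = 1 := by
    rw [Finset.card_erase_of_mem hx, Finset.card_erase_of_mem hw]; unfold dg at h3; omega
  obtain ⟨y, hy⟩ := Finset.card_eq_one.1 h1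
  have hy' : y ∈ ((nb G v).erase w).erase x := by simp [hy]
  have hy2 := Finset.mem_of_mem_erase hy'
  refine ⟨y, Finset.ne_of_mem_erase hy2, Finset.ne_of_mem_erase hy',
    mem_nb.1 (Finset.mem_of_mem_erase hy2), ?_⟩
  rw [← Finset.insert_erase hw, ← Finset.insert_erase hx, hy]

lemma three_nb1 {v w : V} (a : G.Adj v w) (h3 : dg G v = 3) :
    ∃ x y, x ≠ w ∧ y ≠ w ∧ y ≠ x ∧ G.Adj v x ∧ G.Adj v y ∧ nb G v = {w, x, y} := by
  have hw : w ∈ nb G v := mem_nb.2 a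
  have h1 : 0 < ((nb G v).erase w).card := by
    rw [Finset.card_erase_of_mem hw]; unfold dg at h3; omega
  obtain ⟨x, hx⟩ := Finset.card_pos.1 h1
  have hx1 := Finset.ne_of_mem_erase hx
  have hx2 := mem_nb.1 (Finset.mem_of_mem_erase hx)
  obtain ⟨y, h1, h2, h4, h5⟩ := three_nb a hx2 hx1 h3
  exact ⟨x, y, hx1, h1, h2, hx2, h4, h5⟩

lemma XX_one {v w : V} (e : nb G v = {w}) : XX G K v = cl G K w := by simp [XX, e]
lemma XX_two {v w x : V} (hne : x ≠ w) (e : nb G v = {w, x}) :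
    XX G K v = cl G K w + cl G K x := by
  rw [XX, e, Finset.sum_pair hne.symm]
lemma XX_three {v w x y : V} (h1 : x ≠ w) (h2 : y ≠ w) (h3 : y ≠ x) (e : nb G v = {w, x, y}) :
    XX G K v = cl G K w + cl G K x + cl G K y := by
  rw [XX, e, Finset.sum_insert (by simp [h1.symm, h2.symm]), Finset.sum_pair h3.symm, add_assoc]
lemma cl_one {v w : V} (e : nb G v = {w}) : cl G K v = if s(v, w) ∈ K then 1 else 0 := by
  rw [cl_sum, e, Finset.sum_singleton]
lemma cl_two {v w x : V} (hne : x ≠ w) (e : nb G v = {w, x}) :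
    cl G K v = (if s(v, w) ∈ K then 1 else 0) + (if s(v, x) ∈ K then 1 else 0) := by
  rw [cl_sum, e, Finset.sum_pair hne.symm]
lemma cl_three {v w x y : V} (h1 : x ≠ w) (h2 : y ≠ w) (h3 : y ≠ x) (e : nb G v = {w, x, y}) :
    cl G K v = (if s(v, w) ∈ K then 1 else 0) + (if s(v, x) ∈ K then 1 else 0) +
      (if s(v, y) ∈ K then 1 else 0) := by
  rw [cl_sum, e, Finset.sum_insert (by simp [h1.symm, h2.symm]), Finset.sum_pair h3.symm, add_assoc]

/-- splitting the sum `XX` at one neighbour -/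
lemma XX_split {v w : V} (a : G.Adj v w) :
    XX G K v = cl G K w + ∑ u ∈ (nb G v).erase w, cl G K u :=
  (Finset.add_sum_erase _ _ (mem_nb.2 a)).symm

lemma leafX (h : Ctx Δ G K) {w u : V} (a : G.Adj w u) (h1 : dg G u = 1) :
    3 * Δ + 1 ≤ XX G K w := by
  have e := one_nb a.symm h1
  have h2 := h.F2 u w a.symm
  have h3 := cl_one (K := K) e
  have hk : s(u, w) ∈ K := by
    by_contra hk; simp [hk] at h3; omega
  have := h.F1 u w hk
  rw [XX_one e] at this
  omega

lemma leafX' (h : Ctx Δ G K) {w : V} (h1 : 1 ≤ ll G w) : 3 * Δ + 1 ≤ XX G K w := by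
  obtain ⟨u, hu⟩ := Finset.card_pos.1 h1
  rw [Finset.mem_filter] at hu
  exact leafX h (mem_nb.1 hu.1) hu.2

lemma XX_le_ll (w : V) : XX G K w ≤ ll G w + ∑ u ∈ cn G w, cl G K u := by
  unfold XX ll cn
  rw [Finset.card_filter, Finset.sum_filter, ← Finset.sum_add_distrib]
  refine Finset.sum_le_sum fun u hu => ?_
  have := dg_pos (mem_nb.1 hu)
  have := cl_le_dg (K := K) (G := G) u
  split_ifs <;> omega

lemma mem_cn {v w : V} : w ∈ cn G v ↔ G.Adj v w ∧ 2 ≤ dg G w := by simp [cn, mem_nb]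

lemma sum_cn_le (h : Ctx Δ G K) (w : V) : ∑ u ∈ cn G w, cl G K u ≤ dd G w * Δ := by
  have := Finset.sum_le_card_nsmul (cn G w) (cl G K) Δ (fun u _ => cl_le h u)
  simpa [dd] using this

lemma sum_cn_le' (h : Ctx Δ G K) {w u : V} (a : G.Adj w u) (h2 : 2 ≤ dg G u) :
    ∑ u ∈ cn G w, cl G K u ≤ (dd G w - 1) * Δ + cl G K u := by
  have hm : u ∈ cn G w := mem_cn.2 ⟨a, h2⟩
  rw [← Finset.add_sum_erase _ _ hm]
  have := Finset.sum_le_card_nsmul ((cn G w).erase u) (cl G K) Δ (fun u _ => cl_le h u)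
  rw [Finset.card_erase_of_mem hm, smul_eq_mul] at this
  unfold dd
  have e : ∑ x ∈ (cn G w).erase u, cl G K x = ((cn G w).erase u).sum (cl G K) := rfl
  omega

lemma C1 (h : Ctx Δ G K) {w : V} (h1 : 1 ≤ ll G w) : 3 ≤ dd G w := by
  by_contra hc
  have h2 := leafX' h h1
  have h3 := XX_le_ll (K := K) (G := G) w
  have h4 := sum_cn_le h w
  have h5 := dg_eq (G := G) w
  have h6 := h.hdeg w
  have h7 := h.hD
  have : dd G w = 0 ∨ dd G w = 1 ∨ dd G w = 2 := by omega
  rcases this with e | e | e <;> rw [e] at h4 <;> omega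

lemma C2 (h : Ctx Δ G K) {w u : V} (h1 : 1 ≤ ll G w) (h3 : dd G w ≤ 3) (a : G.Adj w u)
    (h2 : 2 ≤ dg G u) : 4 ≤ cl G K u := by
  by_contra hc
  have h2' := leafX' h h1
  have h3 := XX_le_ll (K := K) (G := G) w
  have h4 := sum_cn_le' h a h2
  have h5 := dg_eq (G := G) w
  have h6 := h.hdeg w
  have h7 := h.hD
  have h8 := C1 h h1
  have : dd G w = 3 := by omega
  rw [this] at h4
  omega

lemma C3 (h : Ctx Δ G K) {w : V} (h1 : 2 ≤ dg G w) : 2 ≤ dd G w := by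
  have := dg_eq (G := G) w
  by_cases hl : 1 ≤ ll G w
  · have := C1 h hl; omega
  · omega

lemma C4 (h : Ctx Δ G K) {w : V} (h1 : dg G w ≤ 3) (h2 : 2 ≤ dg G w): dd G w = dg G w ∧ ll G w = 0 := by
  have := dg_eq (G := G) w
  by_cases hl : 1 ≤ ll G w
  · have := C1 h hl; omega
  · omega

lemma C5 (h : Ctx Δ G K) {w : V} (h1 : 3 ≤ dg G w) : 3 ≤ dd G w := by
  have := dg_eq (G := G) w
  by_cases hl : 1 ≤ ll G w
  · have := C1 h hl; omega
  · omega

/-- a vertex with at most three core neighbours, one of which has small `cl`. -/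
lemma C6 (h : Ctx Δ G K) {w u : V} (h3 : dd G w ≤ 3) (a : G.Adj w u)
    (h2 : 2 ≤ dg G u) (hc : cl G K u ≤ 3) : dg G w = dd G w ∧ XX G K w ≤ 2 * Δ + cl G K u := by
  have h4 := dg_eq (G := G) w
  have hl : ll G w = 0 := by
    by_contra hl
    have := C2 h (by omega) h3 a h2
    omega
  have h5 := XX_le_ll (K := K) (G := G) w
  have h6 := sum_cn_le' h a h2
  have : (dd G w - 1) * Δ ≤ 2 * Δ := Nat.mul_le_mul_right _ (by omega)
  omega

lemma D4 (h : Ctx Δ G K) {w u : V} (a : G.Adj w u)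
    (h2 : 2 ≤ dg G u) (hc : cl G K u ≤ 3) (hX : 2 * Δ + cl G K u < XX G K w) : 4 ≤ dd G w := by
  by_contra h3
  have := C6 h (by omega) a h2 hc
  omega

lemma dd4_of (h : Ctx Δ G K) {w u : V} (a : G.Adj w u) (h2 : 2 ≤ dg G u) (h3 : dg G u ≤ 3)
    (h4 : 4 ≤ dg G w) : 4 ≤ dd G w := by
  by_contra hc
  have := C6 h (by omega) a h2 ((cl_le_dg u).trans h3)
  omega

lemma core_nb (h : Ctx Δ G K) {v w : V} (h1 : 2 ≤ dg G v) (h3 : dg G v ≤ 3) (a : G.Adj v w) :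
    2 ≤ dg G w := by
  have h2 := (C4 h h3 h1).2
  have := dg_pos a
  by_contra hc
  have : w ∈ (nb G v).filter (fun w => dg G w = 1) := by
    rw [Finset.mem_filter]; exact ⟨mem_nb.2 a, by omega⟩
  rw [ll, Finset.card_eq_zero] at h2
  rw [h2] at this; simp at this

lemma TwoTwo (h : Ctx Δ G K) {v x : V} (a : G.Adj v x) (hv : dg G v = 2) (hx : dg G x = 2) :
    s(v, x) ∉ K := by
  intro hk
  obtain ⟨y, y1, _, ey⟩ := two_nb a hv
  obtain ⟨z, z1, _, ez⟩ := two_nb a.symm hx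
  have := h.F1 v x hk
  rw [XX_two y1 ey, XX_two z1 ez] at this
  have := cl_le h y
  have := cl_le h z
  have := h.hD
  omega

lemma TT1 (h : Ctx Δ G K) {v x y : V} (a : G.Adj v x) (hv : dg G v = 2) (hx : dg G x = 2)
    (b : G.Adj v y) (hne : y ≠ x) :
    cl G K v = 1 ∧ s(v, y) ∈ K := by
  have e := two_nb' a b hne hv
  have h1 := cl_two (K := K) hne e
  have h2 := h.F2 v x a
  have h3 := TwoTwo h a hv hx
  simp only [h3, if_false] at h1
  split_ifs at h1 with hk
  · exact ⟨by omega, hk⟩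
  · omega

lemma TT (h : Ctx Δ G K) {v x y : V} (a : G.Adj v x) (hv : dg G v = 2) (hx : dg G x = 2)
    (b : G.Adj v y) (hne : y ≠ x) :
    cl G K v = 1 ∧ s(v, y) ∈ K ∧ 3 * Δ ≤ XX G K y ∧ 4 ≤ dd G y := by
  obtain ⟨h1, h2⟩ := TT1 h a hv hx b hne
  obtain ⟨z, z1, bz, ez⟩ := two_nb a.symm hx
  obtain ⟨h3, h4⟩ := TT1 h a.symm hx hv bz z1
  have h5 := h.F1 v y h2
  rw [XX_two hne (two_nb' a b hne hv)] at h5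
  have hX : 3 * Δ ≤ XX G K y := by omega
  have := h.hD
  exact ⟨h1, h2, hX, D4 h b.symm (by omega) (by omega) (by omega)⟩

lemma LP (h : Ctx Δ G K) {u v : V} (hu : dg G u = 3) (hv : dg G v = 2) (a : G.Adj u v)
    (hk : s(u, v) ∈ K) {b : V} (ab : G.Adj u b) (hb : b ≠ v) : cl G K b = Δ ∧ 4 ≤ dd G b := by
  obtain ⟨c, c1, c2, ac, e⟩ := three_nb a ab hb hu
  obtain ⟨y, y1, _, ey⟩ := two_nb a.symm hv
  have h1 := h.F1 u v hk
  rw [XX_three hb c1 c2 e, XX_two y1 ey] at h1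
  have h2 := cl_le h b
  have := cl_le h c
  have := cl_le h y
  have h3 : cl G K b = Δ := by omega
  refine ⟨h3, dd4_of h ab.symm (by omega) (by omega) ?_⟩
  have := cl_le_dg (K := K) (G := G) b
  have := h.hD
  omega

def isS (G : SimpleGraph V) (x : V) : Prop := dg G x = 3 ∧ ∃ v, G.Adj x v ∧ dg G v = 2
def isSm (G : SimpleGraph V) (x : V) : Prop := dg G x = 2 ∨ isS G x
def isT (G : SimpleGraph V) (x : V) : Prop :=
  dg G x = 3 ∧ ∃ v w, v ≠ w ∧ G.Adj x v ∧ G.Adj x w ∧ dg G v = 2 ∧ dg G w = 2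
def isQ (G : SimpleGraph V) (z : V) : Prop :=
  dg G z = 4 ∧ 3 ≤ ((nb G z).filter (isSm G)).card

lemma smallfacts (h : Ctx Δ G K) {u z : V} (hs : isSm G u) (a : G.Adj z u) (hz : dg G z ≠ 2)
    (hc : cl G K z < Δ) : cl G K u ≤ 2 ∧ XX G K u ≤ cl G K z + Δ + 1 ∧
      (s(z, u) ∉ K → cl G K u ≤ 1) := by
  rcases hs with h2 | ⟨h3, v, av, hv⟩
  · obtain ⟨y, y1, _, e⟩ := two_nb a.symm h2
    have h4 := cl_two (K := K) y1 e
    have h5 := XX_two (K := K) y1 e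
    have := cl_le h y
    have := cl_le_dg (K := K) (G := G) u
    refine ⟨by omega, by omega, fun hk => ?_⟩
    rw [Sym2.eq_swap] at hk
    simp only [hk, if_false] at h4
    split_ifs at h4 <;> omega
  · have hzv : v ≠ z := by rintro rfl; exact hz hv
    have hk : s(u, v) ∉ K := fun hk => by
      have := (LP h h3 hv av hk a.symm hzv.symm).1
      omega
    obtain ⟨b, b1, b2, ab, e⟩ := three_nb a.symm av hzv h3
    have h4 := cl_three (K := K) hzv b1 b2 e
    have h5 := XX_three (K := K) hzv b1 b2 e
    have := cl_le h b
    have h6 := cl_succ_le av hk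
    have hk' := hk
    rw [Sym2.eq_swap] at hk'
    have h7 := cl_succ_le av.symm hk'
    refine ⟨by omega, by omega, fun hk2 => ?_⟩
    rw [Sym2.eq_swap] at hk2
    simp only [hk, hk2, if_false] at h4
    split_ifs at h4 <;> omega

lemma cl_zero_of {v : V} (hn : ∀ u, G.Adj v u → s(v, u) ∉ K) : cl G K v = 0 := by
  rw [cl, Finset.card_eq_zero, Finset.filter_eq_empty_iff]
  intro u hu; exact hn u (mem_nb.1 hu)

/-- `s(z,u) ∉ K` for small neighbours. -/
lemma SmallNb (h : Ctx Δ G K) {z : V} (hz : dg G z < Δ) (hz2 : dg G z ≠ 2)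
    (hb : 2 * ((nb G z).filter (isSm G)).card + ((nb G z).filter (fun u => ¬ isSm G u)).card * Δ
      < 2 * Δ + 1) {u : V} (hs : isSm G u) (a : G.Adj z u) : s(z, u) ∉ K := by
  intro hk
  have hc : cl G K z < Δ := lt_of_le_of_lt (cl_le_dg z) hz
  have h1 := h.F1 z u hk
  obtain ⟨h2, h3, _⟩ := smallfacts h hs a hz2 hc
  have h4 := XX_split (K := K) a
  have h5 : ∑ w ∈ (nb G z).erase u, cl G K w + 2 ≤ 2 * ((nb G z).filter (isSm G)).card +
      ((nb G z).filter (fun u => ¬ isSm G u)).card * Δ := by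
    have h6 : ∑ w ∈ (nb G z).erase u, cl G K w + 2 ≤
        ∑ w ∈ nb G z, if isSm G w then 2 else Δ := by
      rw [← Finset.sum_erase_add _ _ (mem_nb.2 a), if_pos hs]
      refine Nat.add_le_add_right (Finset.sum_le_sum fun w hw => ?_) _
      split_ifs with hw'
      · exact (smallfacts h hw' (mem_nb.1 (Finset.mem_of_mem_erase hw)) hz2 hc).1
      · exact cl_le h w
    refine h6.trans (le_of_eq ?_)
    rw [Finset.sum_ite]; simp [mul_comm]
  omega

lemma AllSmall (h : Ctx Δ G K) {z : V} (hz : dg G z < Δ) (hz2 : 3 ≤ dg G z)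
    (hs : ∀ u, G.Adj z u → isSm G u) : False := by
  have h1 : (nb G z).filter (isSm G) = nb G z :=
    Finset.filter_true_of_mem fun u hu => hs u (mem_nb.1 hu)
  have h2 : (nb G z).filter (fun u => ¬ isSm G u) = ∅ := by
    rw [Finset.filter_eq_empty_iff]; intro u hu; simpa using hs u (mem_nb.1 hu)
  have h3 := cl_zero_of (v := z) (K := K) fun u a =>
    SmallNb h hz (by omega) (by rw [h1, h2]; simp; unfold dg at hz; omega) (hs u a) a
  obtain ⟨u, hu⟩ := Finset.card_pos.1 (show 0 < (nb G z).card by unfold dg at hz2; omega)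
  have := h.F2 z u (mem_nb.1 hu)
  omega

lemma Qfacts (h : Ctx Δ G K) {z : V} (hq : isQ G z) :
    cl G K z = 1 ∧ ∃ w, G.Adj w z ∧ ¬ isSm G w ∧ (∀ u, G.Adj z u → u ≠ w → isSm G u) ∧
      4 ≤ dd G w ∧ ∀ w', G.Adj w' z → ¬ isSm G w' → 3 * Δ ≤ XX G K w' + 2 := by
  obtain ⟨h4, h3⟩ := hq
  have hD := h.hD
  have hex : ∃ w, G.Adj z w ∧ ¬ isSm G w := by
    by_contra hc; push Not at hc
    exact AllSmall h (by omega) (by omega) hc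
  obtain ⟨w, aw, hw⟩ := hex
  have hsub : (nb G z).filter (isSm G) = (nb G z).erase w := by
    apply Finset.eq_of_subset_of_card_le
    · intro u hu
      rw [Finset.mem_filter] at hu
      rw [Finset.mem_erase]
      exact ⟨by rintro rfl; exact hw hu.2, hu.1⟩
    · rw [Finset.card_erase_of_mem (mem_nb.2 aw)]; unfold dg at h4; omega
  have hsm : ∀ u, G.Adj z u → u ≠ w → isSm G u := by
    intro u a hne
    have : u ∈ (nb G z).filter (isSm G) := by
      rw [hsub, Finset.mem_erase]; exact ⟨hne, mem_nb.2 a⟩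
    exact (Finset.mem_filter.1 this).2
  have hcs : ((nb G z).erase w).card = 3 := by
    rw [Finset.card_erase_of_mem (mem_nb.2 aw)]; unfold dg at h4; omega
  have hns : (nb G z).filter (fun u => ¬ isSm G u) = {w} := by
    ext u
    rw [Finset.mem_filter, Finset.mem_singleton]
    constructor
    · rintro ⟨h1, h2⟩; by_contra hne; exact h2 (hsm u (mem_nb.1 h1) hne)
    · rintro rfl; exact ⟨mem_nb.2 aw, hw⟩
  have hK : ∀ u, G.Adj z u → u ≠ w → s(z, u) ∉ K := fun u a hne =>
    SmallNb h (by omega) (by omega) (by rw [hns, hsub, hcs]; simp; omega) (hsm u a hne) a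
  have hz1 := h.F2 z w aw
  have hf : (nb G z).filter (fun w => s(z, w) ∈ K) ⊆ {w} := by
    intro u hu
    rw [Finset.mem_filter] at hu
    rw [Finset.mem_singleton]
    by_contra hne; exact hK u (mem_nb.1 hu.1) hne hu.2
  have hc1 : cl G K z = 1 := le_antisymm (by simpa [cl] using Finset.card_le_card hf) hz1
  have hwK : s(z, w) ∈ K := by
    obtain ⟨u, hu⟩ := Finset.card_pos.1 (show 0 < cl G K z by omega)
    have h1 := hf hu
    rw [Finset.mem_singleton] at h1
    subst h1
    exact (Finset.mem_filter.1 hu).2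
  have hX : 3 * Δ ≤ XX G K w + 2 := by
    have h1 := h.F1 z w hwK
    have h2 := XX_split (K := K) aw
    have h5 : ∑ u ∈ (nb G z).erase w, cl G K u ≤ 3 := by
      have := Finset.sum_le_card_nsmul ((nb G z).erase w) (cl G K) 1 (fun u hu => by
        rw [Finset.mem_erase] at hu
        have a := mem_nb.1 hu.2
        exact (smallfacts h (hsm u a hu.1) a (by omega) (by omega)).2.2 (hK u a hu.1))
      simpa [hcs] using this
    omega
  refine ⟨hc1, w, aw.symm, hw, hsm, D4 h aw.symm (by omega) (by omega) (by omega), ?_⟩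
  intro w' a' hw'
  have : w' = w := by by_contra hne; exact hw' (hsm w' a'.symm hne)
  rw [this]; exact hX

lemma Tfacts (h : Ctx Δ G K) {x : V} (ht : isT G x) :
    ∃ a, G.Adj x a ∧ 4 ≤ dd G a ∧ (∀ v, G.Adj x v → v ≠ a → dg G v = 2) ∧
      ∀ v, G.Adj x v → v ≠ a → cl G K v = 1 ∧ ∀ y, G.Adj v y → y ≠ x →
        3 * Δ ≤ XX G K y ∧ 4 ≤ dd G y := by
  obtain ⟨h3, v, w, hvw, av, aw, hv, hw⟩ := ht
  have hD := h.hD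
  obtain ⟨a, a1, a2, aa, e⟩ := three_nb av aw hvw.symm h3
  have hkv : s(x, v) ∉ K := fun hk => by
    have := (LP h h3 hv av hk aw hvw.symm).1
    have := cl_le_dg (K := K) (G := G) w
    omega
  have hkw : s(x, w) ∉ K := fun hk => by
    have := (LP h h3 hw aw hk av hvw).1
    have := cl_le_dg (K := K) (G := G) v
    omega
  have h4 := cl_three (K := K) hvw.symm a1 a2 e
  have h5 := h.F2 x v av
  simp only [hkv, hkw, if_false] at h4
  have hka : s(x, a) ∈ K := by
    by_contra hk; simp only [hk, if_false] at h4; omega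
  simp only [hka, if_true] at h4
  have main : ∀ v, G.Adj x v → dg G v = 2 → s(x, v) ∉ K → cl G K v = 1 ∧ ∀ y, G.Adj v y → y ≠ x →
        3 * Δ ≤ XX G K y ∧ 4 ≤ dd G y := by
    intro v av hv hk
    rw [Sym2.eq_swap] at hk
    have h6 := cl_succ_le av.symm hk
    have h7 := h.F2 v x av.symm
    refine ⟨by omega, fun y ay hy => ?_⟩
    have e := two_nb' av.symm ay hy hv
    have h8 := cl_two (K := K) hy e
    simp only [hk, if_false] at h8
    have hky : s(v, y) ∈ K := by
      by_contra hk; simp only [hk, if_false] at h8; omega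
    have h9 := h.F1 v y hky
    rw [XX_two hy e] at h9
    have hX : 3 * Δ ≤ XX G K y := by omega
    exact ⟨hX, D4 h ay.symm (by omega) (by omega) (by omega)⟩
  have hcase : ∀ u, G.Adj x u → u ≠ a → u = v ∨ u = w := by
    intro u au hu
    have : u ∈ nb G x := mem_nb.2 au
    rw [e] at this
    simp at this
    tauto
  have hv1 := (main v av hv hkv).1
  have hw1 := (main w aw hw hkw).1
  have h6 := h.F1 x a hka
  rw [XX_three hvw.symm a1 a2 e] at h6
  refine ⟨a, aa, D4 h aa.symm (by omega) (by omega) (by omega), ?_, ?_⟩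
  · intro u au hu
    rcases hcase u au hu with rfl | rfl <;> assumption
  · intro u au hu
    rcases hcase u au hu with rfl | rfl
    · exact main _ av hv hkv
    · exact main _ aw hw hkw

lemma Pfacts (h : Ctx Δ G K) {x v a b : V} (h3 : dg G x = 3) (hv : dg G v = 2) (av : G.Adj x v)
    (aa : G.Adj x a) (ab : G.Adj x b) (hav : a ≠ v) (hbv : b ≠ v) (hba : b ≠ a) :
    4 ≤ dd G a ∨ 4 ≤ dd G b := by
  by_contra hc
  push Not at hc
  have hD := h.hD
  have e : nb G x = {v, a, b} := by
    obtain ⟨c, c1, c2, ac, e⟩ := three_nb av aa hav h3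
    have : b ∈ nb G x := mem_nb.2 ab
    rw [e] at this ⊢
    simp [hbv, hba] at this
    rw [this]
  have hkv : s(x, v) ∉ K := fun hk => by
    have := (LP h h3 hv av hk aa hav).2
    omega
  have hx := cl_le_dg (K := K) (G := G) x
  have h4 := C6 h (by omega) aa.symm (by omega) (hx.trans h3.le)
  have h5 := C6 h (by omega) ab.symm (by omega) (hx.trans h3.le)
  have ha := cl_le_dg (K := K) (G := G) a
  have hb := cl_le_dg (K := K) (G := G) b
  have hv' := cl_le_dg (K := K) (G := G) v
  have hX := XX_three (K := K) hav hbv hba e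
  have hka : s(x, a) ∉ K := fun hk => by
    have := h.F1 x a hk
    omega
  have hkb : s(x, b) ∉ K := fun hk => by
    have := h.F1 x b hk
    omega
  have h6 := cl_three (K := K) hav hbv hba e
  simp only [hka, hkb, hkv, if_false] at h6
  have := h.F2 x a aa
  omega

end

section
variable {V : Type} [Fintype V]
variable {G : SimpleGraph V} {K : Finset (Sym2 V)} {Δ : ℕ}

/-- the discharging rule: charge sent from `w` to `z` -/
noncomputable def gf (G : SimpleGraph V) (w z : V) : ℕ :=
  if dg G z = 2 then
    (if 4 ≤ dd G w then
      (if ∃ t, G.Adj z t ∧ dg G t = 2 then 4 else if ∃ t, G.Adj z t ∧ isT G t then 3 else 2)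
     else if dg G w = 3 then (if isT G w then 1 else 2) else 0)
  else if (isS G z ∨ isQ G z) ∧ 4 ≤ dd G w then 2 else 0

noncomputable def oo (G : SimpleGraph V) (w : V) : ℕ := ∑ u ∈ cn G w, gf G w u
noncomputable def ii (G : SimpleGraph V) (w : V) : ℕ := ∑ u ∈ cn G w, gf G u w
noncomputable def ct (G : SimpleGraph V) (w : V) (i : ℕ) : ℕ :=
  ((cn G w).filter (fun u => gf G w u = i)).card

def PLh (Δ : ℕ) (G : SimpleGraph V) (K : Finset (Sym2 V)) : Prop :=
  ∀ w v1 v2, v1 ≠ v2 → G.Adj w v1 → G.Adj w v2 → dg G v1 = 2 → dg G v2 = 2 →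
    (∃ x, G.Adj v1 x ∧ dg G x = 2) → (∃ x, G.Adj v2 x ∧ dg G x = 2) → XX G K w ≠ 3 * Δ

lemma dd_le_dg (w : V) : dd G w ≤ dg G w := Finset.card_filter_le _ _

lemma gf_vals {w u : V} (hw : 4 ≤ dd G w) :
    gf G w u = 0 ∨ gf G w u = 2 ∨ gf G w u = 3 ∨ gf G w u = 4 := by
  unfold gf; simp only [hw, if_true]; split_ifs <;> simp

lemma gf4 (h : Ctx Δ G K) {w u : V} (hw : 4 ≤ dd G w) (a : G.Adj w u) (hg : gf G w u = 4) :
    dg G u = 2 ∧ (∃ t, G.Adj u t ∧ dg G t = 2) ∧ cl G K u = 1 ∧ 3 * Δ ≤ XX G K w := by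
  unfold gf at hg
  simp only [hw, if_true] at hg
  split_ifs at hg <;> try omega
  rename_i h1 h2
  obtain ⟨t, at', ht⟩ := h2
  have hne : w ≠ t := by rintro rfl; have := dd_le_dg (G := G) w; omega
  have := TT h at' h1 ht a.symm hne
  exact ⟨h1, ⟨t, at', ht⟩, this.1, this.2.2.1⟩

lemma gf3 (h : Ctx Δ G K) {w u : V} (hw : 4 ≤ dd G w) (a : G.Adj w u) (hg : gf G w u = 3) :
    dg G u = 2 ∧ cl G K u = 1 ∧ 3 * Δ ≤ XX G K w := by
  unfold gf at hg
  simp only [hw, if_true] at hg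
  split_ifs at hg <;> try omega
  rename_i h1 h2 h3
  obtain ⟨t, at', ht⟩ := h3
  have hne : w ≠ t := by rintro rfl; have := dd_le_dg (G := G) w; have := ht.1; omega
  obtain ⟨b, _, hb, _, h4⟩ := Tfacts h ht
  have hub : u ≠ b := by rintro rfl; have := dd_le_dg (G := G) u; omega
  have := h4 u at'.symm hub
  exact ⟨h1, this.1, (this.2 w a.symm hne).1⟩

lemma gf2 (h : Ctx Δ G K) {w u : V} (hw : 4 ≤ dd G w) (hg : gf G w u = 2) :
    (isSm G u ∨ isQ G u) ∧ cl G K u ≤ 3 := by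
  unfold gf at hg
  simp only [hw, if_true] at hg
  have := cl_le_dg (K := K) (G := G) u
  split_ifs at hg <;> try omega
  · rename_i h1 _ _; exact ⟨Or.inl (Or.inl h1), by omega⟩
  · rename_i h4
    rcases h4.1 with h5 | h5
    · exact ⟨Or.inl (Or.inr h5), by have := h5.1; omega⟩
    · exact ⟨Or.inr h5, by have := (Qfacts h h5).1; omega⟩

lemma gf0 {w u : V} (hw : 4 ≤ dd G w) (hg : gf G w u = 0) :
    dg G u ≠ 2 ∧ ¬ isS G u ∧ ¬ isQ G u := by
  unfold gf at hg
  simp only [hw, if_true] at hg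
  split_ifs at hg <;> try omega
  rename_i h1 h2
  refine ⟨h1, ?_, ?_⟩ <;> intro h5 <;> apply h2 <;> simp [h5]

lemma gf_low {w u : V} (hw : ¬ 4 ≤ dd G w) (h3 : dg G w ≠ 3) : gf G w u = 0 := by
  simp [gf, hw, h3]

lemma gf_low' {w u : V} (hw : ¬ 4 ≤ dd G w) (h3 : dg G u ≠ 2) : gf G w u = 0 := by
  simp [gf, hw, h3]

lemma dd_ct {w : V} (hw : 4 ≤ dd G w) : dd G w = ct G w 0 + ct G w 2 + ct G w 3 + ct G w 4 := by
  unfold ct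
  conv_lhs => unfold dd
  simp only [Finset.card_filter, ← Finset.sum_add_distrib]
  rw [Finset.card_eq_sum_ones]
  refine Finset.sum_congr rfl fun u hu => ?_
  rcases gf_vals (u := u) hw with e | e | e | e <;> simp [e]

lemma oo_ct {w : V} (hw : 4 ≤ dd G w) : oo G w = 2 * ct G w 2 + 3 * ct G w 3 + 4 * ct G w 4 := by
  unfold ct oo
  simp only [Finset.card_filter, ← Finset.sum_add_distrib, Finset.mul_sum]
  refine Finset.sum_congr rfl fun u hu => ?_
  rcases gf_vals (u := u) hw with e | e | e | e <;> simp [e]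

lemma Xpt (h : Ctx Δ G K) {w : V} (hw : 4 ≤ dd G w) (m : ℕ)
    (hm : ∀ u, G.Adj w u → gf G w u = 2 → cl G K u ≤ m) {u : V} (a : G.Adj w u) :
    cl G K u ≤ if gf G w u = 0 then Δ else if gf G w u = 2 then m else 1 := by
  rcases gf_vals (u := u) hw with e | e | e | e <;> simp only [e] <;> simp
  · exact cl_le h u
  · exact hm u a e
  · exact (gf3 h hw a e).2.1.le
  · exact (gf4 h hw a e).2.2.1.le

lemma Xsum {w : V} (hw : 4 ≤ dd G w) (m : ℕ) :
    ∑ u ∈ cn G w, (if gf G w u = 0 then Δ else if gf G w u = 2 then m else 1) =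
      ct G w 0 * Δ + m * ct G w 2 + ct G w 3 + ct G w 4 := by
  unfold ct
  simp only [Finset.card_filter, ← Finset.sum_add_distrib, Finset.mul_sum, Finset.sum_mul]
  refine Finset.sum_congr rfl fun u hu => ?_
  rcases gf_vals (u := u) hw with e | e | e | e <;> simp [e]

lemma Xb (h : Ctx Δ G K) {w : V} (hw : 4 ≤ dd G w) (m : ℕ)
    (hm : ∀ u, G.Adj w u → gf G w u = 2 → cl G K u ≤ m) :
    XX G K w ≤ ct G w 0 * Δ + m * ct G w 2 + ct G w 3 + ct G w 4 + ll G w := by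
  have h1 := XX_le_ll (K := K) (G := G) w
  have h2 : ∑ u ∈ cn G w, cl G K u ≤
      ∑ u ∈ cn G w, (if gf G w u = 0 then Δ else if gf G w u = 2 then m else 1) :=
    Finset.sum_le_sum fun u hu => Xpt h hw m hm (mem_cn.1 hu).1
  rw [Xsum hw] at h2
  omega

lemma Xb' (h : Ctx Δ G K) {w : V} (hw : 4 ≤ dd G w) (m : ℕ)
    (hm : ∀ u, G.Adj w u → gf G w u = 2 → cl G K u ≤ m) {u : V} (a : G.Adj w u)
    (h2 : 2 ≤ dg G u) (hg : gf G w u = 2) :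
    XX G K w + m ≤ cl G K u + ct G w 0 * Δ + m * ct G w 2 + ct G w 3 + ct G w 4 + ll G w := by
  have h1 := XX_le_ll (K := K) (G := G) w
  have hmem : u ∈ cn G w := mem_cn.2 ⟨a, h2⟩
  have h3 : ∑ u ∈ (cn G w).erase u, cl G K u ≤
      ∑ u ∈ (cn G w).erase u, (if gf G w u = 0 then Δ else if gf G w u = 2 then m else 1) :=
    Finset.sum_le_sum fun u hu => by
      have hu := mem_cn.1 (Finset.mem_of_mem_erase hu)
      exact Xpt h hw m hm hu.1
  have h4 := Xsum (Δ := Δ) hw m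
  rw [← Finset.add_sum_erase _ _ hmem] at h1 h4
  rw [hg] at h4
  simp only [if_true] at h4
  norm_num at h4
  omega

lemma ct_pos {w u : V} {i : ℕ} (a : G.Adj w u) (h2 : 2 ≤ dg G u) (hg : gf G w u = i) :
    1 ≤ ct G w i :=
  Finset.card_pos.2 ⟨u, Finset.mem_filter.2 ⟨mem_cn.2 ⟨a, h2⟩, hg⟩⟩

lemma ct_ex {w : V} {i : ℕ} (hp : 1 ≤ ct G w i) : ∃ u, G.Adj w u ∧ 2 ≤ dg G u ∧ gf G w u = i := by
  obtain ⟨u, hu⟩ := Finset.card_pos.1 hp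
  rw [Finset.mem_filter, mem_cn] at hu
  exact ⟨u, hu.1.1, hu.1.2, hu.2⟩

lemma XA (h : Ctx Δ G K) {w : V} (hw : 4 ≤ dd G w) (hp : 1 ≤ ct G w 3 + ct G w 4) :
    3 * Δ ≤ XX G K w := by
  by_cases h3 : 1 ≤ ct G w 3
  · obtain ⟨u, a, _, hg⟩ := ct_ex h3
    exact (gf3 h hw a hg).2.2
  · obtain ⟨u, a, _, hg⟩ := ct_ex (show 1 ≤ ct G w 4 by omega)
    exact (gf4 h hw a hg).2.2.2

lemma PLj (h : Ctx Δ G K) (hPL : PLh Δ G K) {w : V} (hw : 4 ≤ dd G w) (hj : 2 ≤ ct G w 4) :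
    XX G K w ≠ 3 * Δ := by
  obtain ⟨u, hu, v, hv, hne⟩ := Finset.one_lt_card.1 (show 1 < ct G w 4 by omega)
  rw [Finset.mem_filter, mem_cn] at hu hv
  have h1 := gf4 h hw hu.1.1 hu.2
  have h2 := gf4 h hw hv.1.1 hv.2
  exact hPL w u v hne hu.1.1 hv.1.1 h1.1 h2.1 h1.2.1 h2.2.1

lemma outA (h : Ctx Δ G K) (hPL : PLh Δ G K) {w : V} (hw : 4 ≤ dd G w)
    (hp : 1 ≤ ct G w 3 + ct G w 4) : 12 ≤ 4 * ct G w 0 + ct G w 3 + 2 * ct G w 2 := by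
  by_contra hc
  have h1 := XA h hw hp
  have h2 := Xb h hw 3 (fun u _ hg => (gf2 h hw hg).2)
  have h3 := dd_ct hw
  have h4 := dg_eq (G := G) w
  have h5 := h.hdeg w
  have h6 := h.hD
  have h7 := @leafX' _ _ _ _ _ h w
  have h8 : ct G w 0 = 0 ∨ ct G w 0 = 1 ∨ ct G w 0 = 2 := by omega
  rcases h8 with e | e | e <;> rw [e] at h2
  · omega
  · omega
  · exact PLj h hPL hw (by omega) (by omega)

lemma outA0 (h : Ctx Δ G K) (hPL : PLh Δ G K) {w : V} (hw : 4 ≤ dd G w)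
    (hp : 1 ≤ ct G w 3 + ct G w 4) (he : 4 * ct G w 0 + ct G w 3 + 2 * ct G w 2 = 12)
    (hm : ∀ u, G.Adj w u → gf G w u = 2 → cl G K u ≤ 2) :
    ct G w 0 = 3 ∧ ct G w 3 = 0 ∧ ct G w 2 = 0 := by
  have h1 := XA h hw hp
  have h2 := Xb h hw 2 hm
  have h3 := dd_ct hw
  have h4 := dg_eq (G := G) w
  have h5 := h.hdeg w
  have h6 := h.hD
  have h7 := @leafX' _ _ _ _ _ h w
  have h8 : ct G w 0 = 0 ∨ ct G w 0 = 1 ∨ ct G w 0 = 2 ∨ ct G w 0 = 3 := by omega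
  rcases h8 with e | e | e | e <;> rw [e] at h2
  · omega
  · omega
  · exact absurd (show XX G K w = 3 * Δ by omega) (PLj h hPL hw (by omega))
  · omega

lemma NoQ (h : Ctx Δ G K) {w q : V} (hw : 4 ≤ dd G w)
    (hp : ct G w 3 + ct G w 4 = 0) (hk : 4 * dd G w ≤ 2 * ct G w 2 + 12) (a : G.Adj w q)
    (hq : isQ G q) : False := by
  have hq4 := hq.1
  have hg : gf G w q = 2 := by simp [gf, hq, hq4, hw]
  have h1 := Xb' h hw 3 (fun u _ hg => (gf2 h hw hg).2) a (by omega) hg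
  obtain ⟨hc, x, _, _, hsm, _, hX⟩ := Qfacts h hq
  have hns : ¬ isSm G w := by
    have := dd_le_dg (G := G) w
    rintro (e | e)
    · omega
    · have := e.1; omega
  have h2 := hX w a hns
  have h3 := dd_ct hw
  have h4 := dg_eq (G := G) w
  have h5 := h.hdeg w
  have h6 := h.hD
  have h7 := @leafX' _ _ _ _ _ h w
  have h8 : ct G w 0 = 0 ∨ ct G w 0 = 1 ∨ ct G w 0 = 2 := by omega
  by_cases hl : 1 ≤ ll G w
  · have h7 := h7 hl
    rcases h8 with e | e | e <;> rw [e] at h1 <;> omega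
  · rcases h8 with e | e | e <;> rw [e] at h1 <;> omega

lemma ii_ge {w u : V} (a : G.Adj w u) (h2 : 2 ≤ dg G u) : gf G u w ≤ ii G w :=
  Finset.single_le_sum (f := fun u => gf G u w) (fun _ _ => Nat.zero_le _) (mem_cn.2 ⟨a, h2⟩)

lemma ct2_le_small (h : Ctx Δ G K) {w : V} (hw : 4 ≤ dd G w) 
    (hq : ∀ q, G.Adj w q → ¬ isQ G q) : ct G w 2 ≤ ((nb G w).filter (isSm G)).card := by
  apply Finset.card_le_card
  intro u hu
  rw [Finset.mem_filter, mem_cn] at hu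
  rw [Finset.mem_filter, mem_nb]
  exact ⟨hu.1.1, ((gf2 h hw hu.2).1).resolve_right (hq u hu.1.1)⟩

lemma finBig (h : Ctx Δ G K) (hPL : PLh Δ G K) {w : V} (hw : 4 ≤ dd G w) :
    oo G w + 12 ≤ 4 * dd G w + ii G w := by
  have h3 := dd_ct hw
  have h4 := oo_ct hw
  have h5 := h.hdeg w
  have h6 := h.hD
  have h7 := dg_eq (G := G) w
  by_cases hp : 1 ≤ ct G w 3 + ct G w 4
  · have := outA h hPL hw hp
    omega
  by_cases hk : 4 * dd G w < 2 * ct G w 2 + 12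
  swap
  · omega
  have hq : ∀ q, G.Adj w q → ¬ isQ G q := fun q a hq => NoQ h hw (by omega) (by omega) a hq
  have hsm := ct2_le_small h hw hq
  have hl : ll G w = 0 := by
    by_contra hl
    have h7 := leafX' h (show 1 ≤ ll G w by omega)
    have h1 := Xb h hw 3 (fun u _ hg => (gf2 h hw hg).2)
    have h8 : ct G w 0 = 0 ∨ ct G w 0 = 1 := by omega
    rcases h8 with e | e <;> rw [e] at h1 <;> omega
  have hns := Finset.card_filter_le (nb G w) (isSm G)
  have hdg : (nb G w).card = dg G w := rfl
  by_cases hall : ∀ u, G.Adj w u → isSm G u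
  · exact (AllSmall h (by omega) (by omega) hall).elim
  push Not at hall
  obtain ⟨u, au, hu⟩ := hall
  have hlt : ((nb G w).filter (isSm G)).card < (nb G w).card :=
    Finset.card_lt_card (Finset.filter_ssubset.2 ⟨u, mem_nb.2 au, hu⟩)
  have hd : dd G w = 4 ∧ ct G w 2 = 3 := by omega
  have hQ : isQ G w := ⟨by omega, by omega⟩
  obtain ⟨_, y, ay, _, _, hy, _⟩ := Qfacts h hQ
  have h8 := ii_ge ay.symm (by have := dd_le_dg (G := G) y; omega)
  have h9 : gf G y w = 2 := by
    have := hQ.1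
    simp [gf, hQ, hy, this]
  omega

lemma finTwo (h : Ctx Δ G K) {z : V} (hz : dg G z = 2) : oo G z + 12 ≤ 4 * dd G z + ii G z := by
  have hd : dd G z = 2 := by rw [(C4 h (by omega) (by omega)).1, hz]
  have ho : oo G z = 0 := Finset.sum_eq_zero fun u _ => gf_low (by omega) (by omega)
  have hdl := fun x => dd_le_dg (G := G) x
  suffices 4 ≤ ii G z by omega
  have hc : ∀ {y}, G.Adj z y → 2 ≤ dg G y := fun a => core_nb h (by omega) (by omega) a
  by_cases h2 : ∃ t, G.Adj z t ∧ dg G t = 2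
  · obtain ⟨t, at', ht⟩ := h2
    obtain ⟨y, hy, ay, e⟩ := two_nb at' hz
    have h4 := (TT h at' hz ht ay hy).2.2.2
    have h5 := ii_ge ay (hc ay)
    have : gf G y z = 4 := by
      have : ∃ t, G.Adj z t ∧ dg G t = 2 := ⟨t, at', ht⟩
      simp [gf, hz, h4, this]
    omega
  have hii : ∀ {x y}, G.Adj z x → G.Adj z y → x ≠ y → gf G x z + gf G y z ≤ ii G z := by
    intro x y ax ay hne
    rw [← Finset.sum_pair (f := fun u => gf G u z) hne]
    apply Finset.sum_le_sum_of_subset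
    intro u hu
    simp at hu
    rcases hu with rfl | rfl
    · exact mem_cn.2 ⟨ax, hc ax⟩
    · exact mem_cn.2 ⟨ay, hc ay⟩
  by_cases h3 : ∃ t, G.Adj z t ∧ isT G t
  · obtain ⟨t, at', ht⟩ := h3
    obtain ⟨y, hy, ay, e⟩ := two_nb at' hz
    obtain ⟨b, _, hb, _, h4⟩ := Tfacts h ht
    have hub : z ≠ b := by rintro rfl; have := hdl z; omega
    have h5 := ((h4 z at'.symm hub).2 y ay hy).2
    have h6 := hii at' ay hy.symm
    have e1 : gf G y z = 3 := by
      have : ∃ t, G.Adj z t ∧ isT G t := ⟨t, at', ht⟩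
      simp [gf, hz, h5, h2, this]
    have e2 : gf G t z = 1 := by
      have h7 := ht.1
      have : ¬ 4 ≤ dd G t := by have := hdl t; omega
      simp [gf, hz, this, h7, ht]
    omega
  · have key : ∀ {y}, G.Adj z y → gf G y z = 2 := by
      intro y ay
      have h5 := hc ay
      have h6 : dg G y ≠ 2 := fun e => h2 ⟨y, ay, e⟩
      have h7 : ¬ isT G y := fun e => h3 ⟨y, ay, e⟩
      by_cases h8 : dg G y = 3
      · have : ¬ 4 ≤ dd G y := by have := hdl y; omega
        simp [gf, hz, this, h8, h7]
      · have : 4 ≤ dd G y := dd4_of h ay.symm (by omega) (by omega) (by omega)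
        simp [gf, hz, this, h2, h3]
    obtain ⟨x, hx⟩ := Finset.card_pos.1 (show 0 < (nb G z).card by unfold dg at hz; omega)
    have ax := mem_nb.1 hx
    obtain ⟨y, hy, ay, e⟩ := two_nb ax hz
    have := hii ax ay hy.symm
    rw [key ax, key ay] at this
    exact this

lemma finThree (h : Ctx Δ G K) {w : V} (h3 : 3 ≤ dg G w) (hw : ¬ 4 ≤ dd G w) :
    oo G w + 12 ≤ 4 * dd G w + ii G w := by
  have hd : dd G w = 3 := by have := C5 h h3; omega
  suffices oo G w ≤ ii G w by omega
  by_cases hw3 : dg G w = 3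
  swap
  · have ho : oo G w = 0 := Finset.sum_eq_zero fun u _ => gf_low (by omega) (by omega)
    omega
  by_cases h2 : ∃ v, G.Adj w v ∧ dg G v = 2
  swap
  · have ho : oo G w = 0 := Finset.sum_eq_zero fun u hu => gf_low' (by omega) (by
      intro e; exact h2 ⟨u, (mem_cn.1 hu).1, e⟩)
    omega
  have hS : isS G w := ⟨hw3, h2⟩
  have hcn : cn G w = nb G w := by
    apply Finset.filter_true_of_mem
    intro u hu
    exact core_nb h (by omega) (by omega) (mem_nb.1 hu)
  have hin : ∀ {a}, G.Adj w a → 4 ≤ dd G a → 2 ≤ ii G w := by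
    intro a aa ha
    have h5 := ii_ge aa (by have := dd_le_dg (G := G) a; omega)
    have : gf G a w = 2 := by simp [gf, hw3, hS, ha]
    omega
  by_cases hT : isT G w
  · obtain ⟨a, aa, ha, htwo, _⟩ := Tfacts h hT
    have h5 := hin aa ha
    refine le_trans ?_ h5
    unfold oo
    rw [hcn, ← Finset.add_sum_erase _ _ (mem_nb.2 aa), gf_low' hw (by
      have := dd_le_dg (G := G) a; omega), zero_add]
    have := Finset.sum_le_card_nsmul ((nb G w).erase a) (gf G w) 1 (fun u hu => by
      rw [Finset.mem_erase] at hu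
      have := htwo u (mem_nb.1 hu.2) hu.1
      simp [gf, this, hw, hw3, hT])
    rw [Finset.card_erase_of_mem (mem_nb.2 aa)] at this
    have e : (nb G w).card = 3 := hw3
    rw [e] at this
    simpa using this
  · obtain ⟨v, av, hv⟩ := h2
    obtain ⟨a, b, hav, hbv, hba, aa, ab, e⟩ := three_nb1 av hw3
    have hnt : ∀ {u}, G.Adj w u → u ≠ v → dg G u ≠ 2 := fun au hne hu =>
      hT ⟨hw3, v, _, hne.symm, av, au, hv, hu⟩
    have h5 : 2 ≤ ii G w := by
      rcases Pfacts h hw3 hv av aa ab hav hbv hba with h5 | h5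
      · exact hin aa h5
      · exact hin ab h5
    refine le_trans ?_ h5
    unfold oo
    rw [hcn, ← Finset.add_sum_erase _ _ (mem_nb.2 av), Finset.sum_eq_zero (s := (nb G w).erase v)
      (fun u hu => by
        rw [Finset.mem_erase] at hu
        exact gf_low' hw (hnt (mem_nb.1 hu.2) hu.1))]
    simp [gf, hv, hw, hw3, hT]

lemma finAll (h : Ctx Δ G K) (hPL : PLh Δ G K) {w : V} (hw : 2 ≤ dg G w) :
    oo G w + 12 ≤ 4 * dd G w + ii G w := by
  by_cases h4 : 4 ≤ dd G w
  · exact finBig h hPL h4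
  by_cases h2 : dg G w = 2
  · exact finTwo h h2
  · exact finThree h (by omega) h4

noncomputable def cor (G : SimpleGraph V) : Finset V := Finset.univ.filter (fun v => 2 ≤ dg G v)

lemma oo_eq_ii : ∑ v ∈ cor G, oo G v = ∑ v ∈ cor G, ii G v := by
  unfold oo ii
  apply Finset.sum_comm'
  intro x y
  simp only [cor, Finset.mem_filter, Finset.mem_univ, true_and, mem_cn]
  constructor
  · rintro ⟨a, b, c⟩; exact ⟨⟨b.symm, a⟩, c⟩
  · rintro ⟨⟨a, b⟩, c⟩; exact ⟨b, a.symm, c⟩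

/-- everything is tight -/
lemma finZero (h : Ctx Δ G K) (hPL : PLh Δ G K)
    (hP1 : ∑ v ∈ cor G, ((nb G v).filter (· ∈ cor G)).card ≤ 3 * (cor G).card)
    {w : V} (hw : 2 ≤ dg G w) :
    oo G w + 12 = 4 * dd G w + ii G w := by
  have h1 : ∀ v ∈ cor G, oo G v + 12 ≤ 4 * dd G v + ii G v := fun v hv =>
    finAll h hPL (Finset.mem_filter.1 hv).2
  have h2 : ∑ v ∈ cor G, dd G v ≤ 3 * (cor G).card := by
    refine le_trans (le_of_eq (Finset.sum_congr rfl fun v _ => ?_)) hP1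
    unfold dd cn
    congr 1
    apply Finset.filter_congr
    intro u _
    simp [cor]
  by_contra hne
  have hlt : ∑ v ∈ cor G, (oo G v + 12) < ∑ v ∈ cor G, (4 * dd G v + ii G v) := by
    apply Finset.sum_lt_sum h1
    have hwc : w ∈ cor G := by simp [cor, hw]
    exact ⟨w, hwc, lt_of_le_of_ne (h1 w hwc) hne⟩
  rw [Finset.sum_add_distrib, Finset.sum_add_distrib, ← Finset.mul_sum, oo_eq_ii] at hlt
  simp at hlt
  omega

end

section
variable {V : Type} [Fintype V]
variable {G : SimpleGraph V} {K : Finset (Sym2 V)} {Δ : ℕ}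

/-- all final charges vanish -/
def Zero (G : SimpleGraph V) : Prop := ∀ w, 2 ≤ dg G w → oo G w + 12 = 4 * dd G w + ii G w

lemma ZP (h : Ctx Δ G K) (hz : Zero G) {x v a b : V} (h3 : dg G x = 3) (hv : dg G v = 2)
    (av : G.Adj x v) (aa : G.Adj x a) (ab : G.Adj x b) (hav : a ≠ v) (hbv : b ≠ v) (hba : b ≠ a)
    (ha : 4 ≤ dd G a) (hb : 4 ≤ dd G b) : False := by
  have hS : isS G x := ⟨h3, v, av, hv⟩
  have hda := dd_le_dg (G := G) a
  have hdb := dd_le_dg (G := G) b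
  have hdx := dd_le_dg (G := G) x
  have e : nb G x = {v, a, b} := by
    obtain ⟨c, c1, c2, ac, e⟩ := three_nb av aa hav h3
    have : b ∈ nb G x := mem_nb.2 ab
    rw [e] at this ⊢
    simp [hbv, hba] at this
    rw [this]
  have h1 : oo G x ≤ 2 := by
    have h1 : oo G x ≤ ∑ u ∈ nb G x, gf G x u :=
      Finset.sum_le_sum_of_subset (Finset.filter_subset _ _)
    rw [e, Finset.sum_insert (by simp [hav.symm, hbv.symm]), Finset.sum_pair hba.symm,
      gf_low' (u := a) (by omega) (by omega), gf_low' (u := b) (by omega) (by omega)] at h1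
    have h2 : gf G x v ≤ 2 := by
      have : ¬ 4 ≤ dd G x := by omega
      simp only [gf, hv, this, h3, if_true, if_false]
      split_ifs <;> omega
    omega
  have h2 : gf G a x + gf G b x ≤ ii G x := by
    rw [← Finset.sum_pair (f := fun u => gf G u x) hba.symm]
    apply Finset.sum_le_sum_of_subset
    intro u hu
    simp at hu
    rcases hu with rfl | rfl
    · exact mem_cn.2 ⟨aa, by omega⟩
    · exact mem_cn.2 ⟨ab, by omega⟩
  have h4 : gf G a x = 2 := by simp [gf, h3, hS, ha]
  have h5 : gf G b x = 2 := by simp [gf, h3, hS, hb]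
  have h6 := hz x (by omega)
  have h7 := (C4 h h3.le (by omega)).1
  omega

lemma S_notK (h : Ctx Δ G K) (hz : Zero G) {x v : V} (h3 : dg G x = 3) (hv : dg G v = 2)
    (av : G.Adj x v) : s(x, v) ∉ K := by
  intro hk
  obtain ⟨a, b, hav, hbv, hba, aa, ab, e⟩ := three_nb1 av h3
  exact ZP h hz h3 hv av aa ab hav hbv hba (LP h h3 hv av hk aa hav).2 (LP h h3 hv av hk ab hbv).2

lemma Zm (h : Ctx Δ G K) (hz : Zero G) {w u : V} (hw : 4 ≤ dd G w) (hg : gf G w u = 2) :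
    cl G K u ≤ 2 := by
  rcases (gf2 h hw hg).1 with (h2 | ⟨h3, v, av, hv⟩) | hq
  · exact h2 ▸ cl_le_dg u
  · have := cl_succ_le av (S_notK h hz h3 hv av)
    omega
  · have := (Qfacts h hq).1; omega

lemma Zall (h : Ctx Δ G K) (hPL : PLh Δ G K) (hz : Zero G) {w : V} (hw : 4 ≤ dd G w)
    (hp : 1 ≤ ct G w 3 + ct G w 4) : ct G w 0 = 3 ∧ ct G w 3 = 0 ∧ ct G w 2 = 0 := by
  have h1 := outA h hPL hw hp
  have h2 := hz w (by have := dd_le_dg (G := G) w; omega)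
  have h3 := dd_ct hw
  have h4 := oo_ct hw
  exact outA0 h hPL hw hp (by omega) (fun u _ hg => Zm h hz hw hg)

lemma noT (h : Ctx Δ G K) (hPL : PLh Δ G K) (hz : Zero G) (x : V) : ¬ isT G x := by
  intro ht
  obtain ⟨a, _, ha, _, h4⟩ := Tfacts h ht
  have ht' := ht
  obtain ⟨h3, v, _, _, av, _, hv, _⟩ := ht'
  have hva : v ≠ a := by rintro rfl; have := dd_le_dg (G := G) v; omega
  obtain ⟨y, hy, ay, e⟩ := two_nb av.symm hv
  have h5 := ((h4 v av hva).2 y ay hy).2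
  have h6 := dd_le_dg (G := G) y
  have h7 : ¬ ∃ t, G.Adj v t ∧ dg G t = 2 := by
    rintro ⟨t, at', ht2⟩
    have : t ∈ nb G v := mem_nb.2 at'
    rw [e] at this
    simp at this
    rcases this with rfl | rfl <;> omega
  have h8 : ∃ t, G.Adj v t ∧ isT G t := ⟨x, av.symm, ht⟩
  have h9 : gf G y v = 3 := by simp [gf, hv, h5, h7, h8]
  have h10 := ct_pos ay.symm hv.ge h9
  have := Zall h hPL hz h5 (by omega)
  omega

lemma noQ (h : Ctx Δ G K) (hPL : PLh Δ G K) (hz : Zero G) (z : V) : ¬ isQ G z := by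
  intro hq
  obtain ⟨_, w, aw, _, _, hw, _⟩ := Qfacts h hq
  have hq4 := hq.1
  have hg : gf G w z = 2 := by simp [gf, hq, hq4, hw]
  have h1 := ct_pos aw (by omega) hg
  have h2 := hz w (by have := dd_le_dg (G := G) w; omega)
  have h3 := dd_ct hw
  have h4 := oo_ct hw
  by_cases hp : 1 ≤ ct G w 3 + ct G w 4
  · have := Zall h hPL hz hw hp; omega
  · exact NoQ h hw (by omega) (by omega) aw hq

/-- type Z vertices -/
lemma Zty (h : Ctx Δ G K) (hPL : PLh Δ G K) (hz : Zero G) {w : V} (hw : 4 ≤ dd G w)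
    (hp : ct G w 3 + ct G w 4 = 0) :
    ll G w = 0 ∧ dg G w = dd G w ∧ ((ct G w 0 = 2 ∧ ct G w 2 = 2 ∧ dd G w = 4) ∨
      (ct G w 0 = 1 ∧ ct G w 2 = 4 ∧ dd G w = 5)) := by
  have hdl := dd_le_dg (G := G) w
  have h2 := hz w (by omega)
  have h3 := dd_ct hw
  have h4 := oo_ct hw
  have h5 : ii G w = 0 := Finset.sum_eq_zero fun u _ => by
    have e1 : dg G w ≠ 2 := by omega
    have e2 : ¬ isS G w := fun e => by have := e.1; omega
    have e3 := noQ h hPL hz w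
    simp [gf, e1, e2, e3]
  have h6 := Xb h hw 2 (fun u _ hg => Zm h hz hw hg)
  have h7 := @leafX' _ _ _ _ _ h w
  have h8 := dg_eq (G := G) w
  have h9 := h.hdeg w
  have hD := h.hD
  have hl : ll G w = 0 := by
    by_contra hl
    have h7 := h7 (by omega)
    have h8 : ct G w 0 = 0 ∨ ct G w 0 = 1 ∨ ct G w 0 = 2 := by omega
    rcases h8 with e | e | e <;> rw [e] at h6 <;> omega
  refine ⟨hl, by omega, ?_⟩
  by_cases h6 : ct G w 0 = 0
  · exfalso
    refine AllSmall h (z := w) (by omega) (by omega) fun u au => ?_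
    have h2u : 2 ≤ dg G u := by
      by_contra hc
      have hd := dg_pos au
      have : u ∈ (nb G w).filter (fun w => dg G w = 1) := by
        rw [Finset.mem_filter]; exact ⟨mem_nb.2 au, by omega⟩
      rw [ll, Finset.card_eq_zero] at hl
      rw [hl] at this; simp at this
    have hpos := fun {i} (hg : gf G w u = i) => ct_pos au h2u hg
    rcases gf_vals (u := u) hw with e | e | e | e
    · have := hpos e; omega
    · exact ((gf2 h hw e).1).resolve_right (noQ h hPL hz u)
    · have := hpos e; omega
    · have := hpos e; omega
  · omega

/-- bound for XX of a type Z vertex minus a neighbour with gift 2 -/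
lemma ZX (h : Ctx Δ G K) (hPL : PLh Δ G K) (hz : Zero G) {w u : V} (hw : 4 ≤ dd G w)
    (hp : ct G w 3 + ct G w 4 = 0) (a : G.Adj w u) (h2 : 2 ≤ dg G u) (hg : gf G w u = 2) :
    (dd G w = 4 ∧ XX G K w ≤ cl G K u + 2 * Δ + 2) ∨
    (dd G w = 5 ∧ XX G K w ≤ cl G K u + Δ + 6) := by
  have h1 := Xb' h hw 2 (fun u _ hg => Zm h hz hw hg) a h2 hg
  obtain ⟨hl, _, h3⟩ := Zty h hPL hz hw hp
  rcases h3 with ⟨e1, e2, e3⟩ | ⟨e1, e2, e3⟩ <;> rw [e1] at h1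
  · left; omega
  · right; omega

lemma ZofGift (h : Ctx Δ G K) (hPL : PLh Δ G K) (hz : Zero G) {w u : V} (hw : 4 ≤ dd G w)
    (a : G.Adj w u) (h2 : 2 ≤ dg G u) (hg : gf G w u = 2) : ct G w 3 + ct G w 4 = 0 := by
  by_contra hp
  have := Zall h hPL hz hw (by omega)
  have := ct_pos a h2 hg
  omega

lemma noS (h : Ctx Δ G K) (hPL : PLh Δ G K) (hz : Zero G) (x : V) : ¬ isS G x := by
  intro hS
  have hS' := hS
  obtain ⟨h3, v, av, hv⟩ := hS'
  have hD := h.hD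
  -- main argument for fixed orientation
  have main : ∀ a b, G.Adj x a → G.Adj x b → a ≠ v → b ≠ v → b ≠ a → 4 ≤ dd G a → False := by
    intro w b aw ab hwv hbv hbw hw
    have hb : ¬ 4 ≤ dd G b := fun hb => ZP h hz h3 hv av aw ab hwv hbv hbw hw hb
    have e : nb G x = {v, w, b} := by
      obtain ⟨c, c1, c2, ac, e⟩ := three_nb av aw hwv h3
      have : b ∈ nb G x := mem_nb.2 ab
      rw [e] at this ⊢
      simp [hbv, hbw] at this
      rw [this]
    have hg : gf G w x = 2 := by simp [gf, h3, hS, hw]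
    have hp := ZofGift h hPL hz hw aw.symm (by omega) hg
    have hX := ZX h hPL hz hw hp aw.symm (by omega) hg
    have hty := Zty h hPL hz hw hp
    have hkv := S_notK h hz h3 hv av
    have hkv' := hkv
    rw [Sym2.eq_swap] at hkv'
    have hv1 := cl_succ_le av.symm hkv'
    have hx := cl_le_dg (K := K) (G := G) x
    have hC := C6 h (by omega) ab.symm (by omega) (hx.trans h3.le)
    have hb3 := cl_le_dg (K := K) (G := G) b
    have hw3 := cl_le_dg (K := K) (G := G) w
    have hXx := XX_three (K := K) hwv hbv hbw e
    have hkw : s(x, w) ∉ K := fun hk => by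
      have := h.F1 x w hk
      omega
    have hkb : s(x, b) ∉ K := fun hk => by
      have := h.F1 x b hk
      omega
    have h6 := cl_three (K := K) hwv hbv hbw e
    simp only [hkw, hkb, hkv, if_false] at h6
    have := h.F2 x w aw
    omega
  obtain ⟨a, b, hav, hbv, hba, aa, ab, e⟩ := three_nb1 av h3
  rcases Pfacts h h3 hv av aa ab hav hbv hba with h5 | h5
  · exact main a b aa ab hav hbv hba h5
  · exact main b a ab aa hbv hav hba.symm h5

/-- A Two at a type Z vertex: the other end is of type Z as well. -/
lemma ZTwo (h : Ctx Δ G K) (hPL : PLh Δ G K) (hz : Zero G) {w u : V} (hw : 4 ≤ dd G w)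
    (a : G.Adj w u) (hg : gf G w u = 2) : dg G u = 2 ∧ ∃ y, y ≠ w ∧ G.Adj u y ∧ nb G u = {w, y} ∧
      4 ≤ dd G y ∧ gf G y u = 2 := by
  have hu : dg G u = 2 := by
    rcases (gf2 h hw hg).1 with (h2 | hs) | hq
    · exact h2
    · exact (noS h hPL hz u hs).elim
    · exact (noQ h hPL hz u hq).elim
  obtain ⟨y, hy, ay, e⟩ := two_nb a.symm hu
  have h2 : ¬ ∃ t, G.Adj u t ∧ dg G t = 2 := by
    intro h2
    simp [gf, hu, hw, h2] at hg
  have h3 : ¬ ∃ t, G.Adj u t ∧ isT G t := by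
    rintro ⟨t, _, ht⟩; exact noT h hPL hz t ht
  have h4 := core_nb h (by omega) (by omega) ay
  have h5 : dg G y ≠ 2 := fun e => h2 ⟨y, ay, e⟩
  have h6 : dg G y ≠ 3 := fun e => noS h hPL hz y ⟨e, u, ay.symm, hu⟩
  have h7 : 4 ≤ dd G y := dd4_of h ay.symm (by omega) (by omega) (by omega)
  exact ⟨hu, y, hy, ay, e, h7, by simp [gf, hu, h7, h2, h3]⟩

lemma Zcl (h : Ctx Δ G K) (hPL : PLh Δ G K) (hz : Zero G) {w : V} (hw : 4 ≤ dd G w)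
    (hp : ct G w 3 + ct G w 4 = 0) : cl G K w ≤ 4 := by
  obtain ⟨_, hdg, hty⟩ := Zty h hPL hz hw hp
  have hc := cl_le_dg (K := K) (G := G) w
  rcases hty with hty | hty
  · omega
  obtain ⟨u, a, h2, hg⟩ := ct_ex (show 1 ≤ ct G w 2 by omega)
  obtain ⟨hu, y, hy, ay, e, hy4, hgy⟩ := ZTwo h hPL hz hw a hg
  have hpy := ZofGift h hPL hz hy4 ay.symm h2 hgy
  have htyy := Zty h hPL hz hy4 hpy
  have hcy := cl_le_dg (K := K) (G := G) y
  have hX := ZX h hPL hz hw hp a h2 hg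
  have hk : s(w, u) ∉ K := fun hk => by
    have := h.F1 w u hk
    rw [XX_two hy e] at this
    have := h.hD
    omega
  have := cl_succ_le a hk
  omega

lemma noZ (h : Ctx Δ G K) (hPL : PLh Δ G K) (hz : Zero G) {w : V} (hw : 4 ≤ dd G w) :
    ct G w 0 = 3 ∧ ct G w 3 = 0 ∧ ct G w 2 = 0 := by
  by_cases hp : 1 ≤ ct G w 3 + ct G w 4
  · exact Zall h hPL hz hw hp
  exfalso
  have hp : ct G w 3 + ct G w 4 = 0 := by omega
  obtain ⟨_, hdg, hty⟩ := Zty h hPL hz hw hp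
  obtain ⟨u, a, h2, hg⟩ := ct_ex (show 1 ≤ ct G w 2 by omega)
  obtain ⟨hu, y, hy, ay, e, hy4, hgy⟩ := ZTwo h hPL hz hw a hg
  have hpy := ZofGift h hPL hz hy4 ay.symm h2 hgy
  have hcw := Zcl h hPL hz hw hp
  have hcy := Zcl h hPL hz hy4 hpy
  have hX := ZX h hPL hz hw hp a h2 hg
  have hXy := ZX h hPL hz hy4 hpy ay.symm h2 hgy
  have hD := h.hD
  have hXu := XX_two (K := K) hy e
  have hk : s(u, w) ∉ K := fun hk => by
    have := h.F1 u w hk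
    omega
  have hky : s(u, y) ∉ K := fun hk => by
    have := h.F1 u y hk
    omega
  have h6 := cl_two (K := K) hy e
  simp only [hk, hky, if_false] at h6
  have := h.F2 u w a.symm
  omega

lemma regular3 (h : Ctx Δ G K) (hPL : PLh Δ G K) (hz : Zero G) {w : V} (hw : 3 ≤ dg G w) :
    ((nb G w).filter (fun u => 3 ≤ dg G u)).card = 3 := by
  by_cases h4 : 4 ≤ dd G w
  · obtain ⟨h0, h3, h2⟩ := noZ h hPL hz h4
    refine Eq.trans ?_ h0
    rw [ct]
    congr 1
    ext u
    rw [Finset.mem_filter, Finset.mem_filter, mem_cn, mem_nb]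
    constructor
    · rintro ⟨a, hu⟩
      have hu2 : 2 ≤ dg G u := by omega
      refine ⟨⟨a, hu2⟩, ?_⟩
      rcases gf_vals (u := u) h4 with e | e | e | e
      · exact e
      · have := ct_pos a hu2 e; omega
      · have := ct_pos a hu2 e; omega
      · have := (gf4 h h4 a e).1; omega
    · rintro ⟨⟨a, hu2⟩, e⟩
      have := (gf0 h4 e).1
      exact ⟨a, by omega⟩
  · have hd : dd G w = 3 := by have := C5 h hw; omega
    refine Eq.trans ?_ hd
    rw [dd, cn]
    congr 1
    apply Finset.filter_congr
    intro u hu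
    have a := mem_nb.1 hu
    constructor
    · intro h; omega
    · intro h2
      by_contra hc
      have hu2 : dg G u = 2 := by omega
      have hcu := cl_le_dg (K := K) (G := G) u
      have := (C6 h (by omega) a h2 (by omega)).1
      exact noS h hPL hz w ⟨by omega, u, a, hu2⟩

lemma exists3 (h : Ctx Δ G K) {u v : V} (hK : s(u, v) ∈ K) (a : G.Adj u v) :
    ∃ w, 3 ≤ dg G w := by
  have key : ∀ {x y}, G.Adj x y → dg G x = 2 → ∃ w, 3 ≤ dg G w := by
    intro x y axy hx
    have h2 := core_nb h (by omega) (by omega) axy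
    by_cases h3 : 3 ≤ dg G y
    · exact ⟨y, h3⟩
    · obtain ⟨z, hz, az, e⟩ := two_nb axy hx
      have := (TT h axy hx (by omega) az hz).2.2.2
      exact ⟨z, by have := dd_le_dg (G := G) z; omega⟩
  have hu := dg_pos a.symm
  have hv := dg_pos a
  by_cases hu2 : dg G u = 2
  · exact key a hu2
  by_cases hv2 : dg G v = 2
  · exact key a.symm hv2
  by_cases hu3 : 3 ≤ dg G u
  · exact ⟨u, hu3⟩
  by_cases hv3 : 3 ≤ dg G v
  · exact ⟨v, hv3⟩
  have e1 := one_nb a (by omega)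
  have e2 := one_nb a.symm (by omega)
  have := h.F1 u v hK
  rw [XX_one e1, XX_one e2] at this
  have := h.hD
  omega

/-- The combinatorial part. -/
theorem comb (h : Ctx Δ G K) (hPL : PLh Δ G K)
    (hP1 : ∀ A : Finset V, ∑ v ∈ A, ((nb G v).filter (· ∈ A)).card ≤ 3 * A.card)
    (hP3 : ¬ Has3RegularSubgraph G) {u v : V} (hK : s(u, v) ∈ K) (a : G.Adj u v) : False := by
  have hz : Zero G := fun w hw => finZero h hPL (hP1 _) hw
  apply hP3
  let H : SimpleGraph V :=
    { Adj := fun x y => G.Adj x y ∧ 3 ≤ dg G x ∧ 3 ≤ dg G y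
      symm := ⟨fun x y hxy => ⟨hxy.1.symm, hxy.2.2, hxy.2.1⟩⟩
      loopless := ⟨fun x hx => G.loopless.irrefl x hx.1⟩ }
  have hH : ∀ x y, H.Adj x y ↔ G.Adj x y ∧ 3 ≤ dg G x ∧ 3 ≤ dg G y := fun _ _ => Iff.rfl
  have hc : ∀ x, 3 ≤ dg G x → (H.neighborSet x).ncard = 3 := by
    intro x hx
    rw [← regular3 h hPL hz hx, ← Set.ncard_coe_finset]
    congr 1
    ext y
    simp [hH, mem_nb, hx]
  refine ⟨H, fun x y hxy => hxy.1, ?_, ?_⟩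
  · obtain ⟨w, hw⟩ := exists3 h hK a
    have h1 := hc w hw
    obtain ⟨y, hy⟩ := Set.nonempty_of_ncard_ne_zero (show (H.neighborSet w).ncard ≠ 0 by omega)
    exact ⟨w, y, hy⟩
  · rintro x ⟨y, hy⟩
    exact hc x hy.2.1

end

section
variable {V : Type} [Fintype V]
variable {G : SimpleGraph V} {K : Finset (Sym2 V)} {Δ : ℕ}

lemma conflict_iff {V : Type} (G : SimpleGraph V) (e e' : Sym2 V) :
    Conflict G e e' ↔ e ≠ e' ∧ ∃ p ∈ e, ∃ q ∈ e', p = q ∨ G.Adj p q := by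
  unfold Conflict
  refine and_congr_right fun _ => ?_
  constructor
  · rintro (⟨v, h1, h2⟩ | ⟨f, hf, ⟨p, hp, hpf⟩, ⟨q, hq, hqf⟩⟩)
    · exact ⟨v, h1, v, h2, Or.inl rfl⟩
    · refine ⟨p, hp, q, hq, ?_⟩
      by_cases hpq : p = q
      · exact Or.inl hpq
      · right
        have : f = s(p, q) := (Sym2.mem_and_mem_iff hpq).1 ⟨hpf, hqf⟩
        rw [this] at hf
        exact hf
  · rintro ⟨p, hp, q, hq, rfl | a⟩
    · exact Or.inl ⟨p, hp, hq⟩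
    · exact Or.inr ⟨s(p, q), a, ⟨p, hp, by simp⟩, ⟨q, hq, by simp⟩⟩

lemma conflict_symm {V : Type} {G : SimpleGraph V} {e e' : Sym2 V} (h : Conflict G e e') :
    Conflict G e' e := by
  rw [conflict_iff] at h ⊢
  obtain ⟨h1, p, hp, q, hq, h2⟩ := h
  refine ⟨h1.symm, q, hq, p, hp, ?_⟩
  rcases h2 with rfl | h2
  · exact Or.inl rfl
  · exact Or.inr h2.symm

lemma conf_edge {V : Type} {G : SimpleGraph V} {u v : V} {e' : Sym2 V} (he' : e' ∈ G.edgeSet)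
    (h : Conflict G s(u, v) e') :
    ∃ w ∈ e', (G.Adj u w ∧ w ≠ v) ∨ (G.Adj v w ∧ w ≠ u) := by
  rw [conflict_iff] at h
  obtain ⟨hne, p, hp, q, hq, h⟩ := h
  have share : ∀ x, x ∈ e' → x = u ∨ x = v →
      ∃ w ∈ e', (G.Adj u w ∧ w ≠ v) ∨ (G.Adj v w ∧ w ≠ u) := by
    intro x hx hx2
    obtain ⟨t, rfl⟩ := Sym2.mem_iff_exists.1 hx
    have a : G.Adj x t := he'
    refine ⟨t, by simp, ?_⟩
    rcases hx2 with rfl | rfl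
    · left; exact ⟨a, by rintro rfl; exact hne rfl⟩
    · right; exact ⟨a, by rintro rfl; exact hne Sym2.eq_swap⟩
  by_cases hquv : q = u ∨ q = v
  · exact share q hq hquv
  push Not at hquv
  rw [Sym2.mem_iff] at hp
  rcases h with rfl | h
  · rcases hp with e | e
    · exact absurd e hquv.1
    · exact absurd e hquv.2
  · rcases hp with rfl | rfl
    · exact ⟨q, hq, Or.inl ⟨h, hquv.2⟩⟩
    · exact ⟨q, hq, Or.inr ⟨h, hquv.1⟩⟩

/-- proper partial colouring -/
def Pr (G : SimpleGraph V) (K : Finset (Sym2 V)) {k : ℕ} (C : Sym2 V → Fin k) : Prop :=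
  ∀ e ∈ K, ∀ e' ∈ K, Conflict G e e' → C e ≠ C e'

structure Crit (Δ : ℕ) (G : SimpleGraph V) (K : Finset (Sym2 V)) : Prop where
  KE : ∀ e ∈ K, e ∈ G.edgeSet
  no : ∀ C : Sym2 V → Fin (3 * Δ), ¬ Pr G K C
  crit : ∀ e ∈ K, ∃ C : Sym2 V → Fin (3 * Δ), Pr G (K.erase e) C

lemma exists_crit (hn : ¬ HasStrongColoring G (3 * Δ)) : ∃ K, Crit Δ G K := by
  let F : Finset (Finset (Sym2 V)) := Finset.univ.filter
    (fun K => (∀ e ∈ K, e ∈ G.edgeSet) ∧ ∀ C : Sym2 V → Fin (3 * Δ), ¬ Pr G K C)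
  have hF : F.Nonempty := by
    refine ⟨Finset.univ.filter (· ∈ G.edgeSet), ?_⟩
    simp only [F, Finset.mem_filter, Finset.mem_univ, true_and]
    refine ⟨fun e he => he, fun C hC => hn ⟨C, fun e he e' he' hc => hC e ?_ e' ?_ hc⟩⟩
    · simpa using he
    · simpa using he'
  obtain ⟨K, hK, hmin⟩ := Finset.exists_min_image F Finset.card hF
  simp only [F, Finset.mem_filter, Finset.mem_univ, true_and] at hK hmin
  refine ⟨K, hK.1, hK.2, fun e he => ?_⟩
  by_contra hc
  push Not at hc
  have := hmin (K.erase e) ⟨fun e' h' => hK.1 e' (Finset.mem_of_mem_erase h'), hc⟩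
  have h2 := Finset.card_erase_lt_of_mem he
  omega

lemma exists_color {k : ℕ} (S : Finset (Fin k)) (h : S.card < k) : ∃ c, c ∉ S := by
  by_contra hc
  push Not at hc
  have : S = Finset.univ := by ext; simp [hc]
  rw [this] at h
  simp at h

lemma crit_deg (h : Crit Δ G K) {e : Sym2 V} (he : e ∈ K) :
    3 * Δ ≤ ((K.erase e).filter (fun e' => Conflict G e e')).card := by
  by_contra hc
  obtain ⟨C, hC⟩ := h.crit e he
  obtain ⟨c, hcS⟩ := exists_color
    (((K.erase e).filter (fun e' => Conflict G e e')).image C)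
    (lt_of_le_of_lt Finset.card_image_le (by omega))
  have hcS' : ∀ e' ∈ K, e' ≠ e → Conflict G e e' → C e' ≠ c := by
    intro e' h1 h2 h3 h4
    apply hcS
    rw [Finset.mem_image]
    exact ⟨e', by simp [h1, h2, h3], h4⟩
  apply h.no (Function.update C e c)
  intro a ha b hb hab
  by_cases hae : a = e
  · subst hae
    have hba : b ≠ a := hab.1.symm
    rw [Function.update_self, Function.update_of_ne hba]
    exact (hcS' b hb hba hab).symm
  · by_cases hbe : b = e
    · subst hbe
      rw [Function.update_self, Function.update_of_ne hae]
      exact hcS' a ha hae (conflict_symm hab)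
    · rw [Function.update_of_ne hae, Function.update_of_ne hbe]
      exact hC a (by simp [ha, hae]) b (by simp [hb, hbe]) hab

/-- K-edges at a vertex -/
noncomputable def Kat (G : SimpleGraph V) (K : Finset (Sym2 V)) (w : V) : Finset (Sym2 V) :=
  ((nb G w).filter (fun u => s(w, u) ∈ K)).image (fun u => s(w, u))

lemma Kat_card (w : V) : (Kat G K w).card ≤ cl G K w := Finset.card_image_le

lemma mem_Kat (hKE : ∀ e ∈ K, e ∈ G.edgeSet) {e : Sym2 V} {w : V} (he : e ∈ K) (hw : w ∈ e) :
    e ∈ Kat G K w := by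
  obtain ⟨t, rfl⟩ := Sym2.mem_iff_exists.1 hw
  rw [Kat, Finset.mem_image]
  exact ⟨t, Finset.mem_filter.2 ⟨mem_nb.2 (hKE _ he), he⟩, rfl⟩

lemma cl_pos_of (hKE : ∀ e ∈ K, e ∈ G.edgeSet) {e : Sym2 V} {w : V} (he : e ∈ K) (hw : w ∈ e) :
    1 ≤ cl G K w :=
  le_trans (Finset.card_pos.2 ⟨e, mem_Kat hKE he hw⟩) (Kat_card w)

lemma crit_F1 (h : Crit Δ G K) (u v : V) (hk : s(u, v) ∈ K) :
    3 * Δ + cl G K u + cl G K v ≤ XX G K u + XX G K v := by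
  have h1 := crit_deg h hk
  have a : G.Adj u v := h.KE _ hk
  have h2 : (K.erase s(u, v)).filter (fun e' => Conflict G s(u, v) e') ⊆
      ((nb G u).erase v).biUnion (Kat G K) ∪ ((nb G v).erase u).biUnion (Kat G K) := by
    intro e' he'
    rw [Finset.mem_filter, Finset.mem_erase] at he'
    obtain ⟨⟨_, hK'⟩, hc⟩ := he'
    obtain ⟨w, hw, h3⟩ := conf_edge (h.KE _ hK') hc
    rw [Finset.mem_union, Finset.mem_biUnion, Finset.mem_biUnion]
    rcases h3 with ⟨h4, h5⟩ | ⟨h4, h5⟩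
    · exact Or.inl ⟨w, Finset.mem_erase.2 ⟨h5, mem_nb.2 h4⟩, mem_Kat h.KE hK' hw⟩
    · exact Or.inr ⟨w, Finset.mem_erase.2 ⟨h5, mem_nb.2 h4⟩, mem_Kat h.KE hK' hw⟩
  have h3 := Finset.card_le_card h2
  have h4 := Finset.card_union_le (((nb G u).erase v).biUnion (Kat G K))
    (((nb G v).erase u).biUnion (Kat G K))
  have h5 : ∀ S : Finset V, (S.biUnion (Kat G K)).card ≤ ∑ w ∈ S, cl G K w := fun S =>
    Finset.card_biUnion_le.trans (Finset.sum_le_sum fun w _ => Kat_card w)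
  have h6 := h5 ((nb G u).erase v)
  have h7 := h5 ((nb G v).erase u)
  have h8 := XX_split (K := K) a
  have h9 := XX_split (K := K) a.symm
  omega

/-- convenient form of goodness -/
structure Good (Δ : ℕ) (G : SimpleGraph V) : Prop where
  P1 : ∀ A : Finset V, ∑ v ∈ A, ((nb G v).filter (· ∈ A)).card ≤ 3 * A.card
  P2 : ∀ v, dg G v ≤ Δ
  P3 : ¬ Has3RegularSubgraph G

lemma nb_mono {H G : SimpleGraph V} (hle : H ≤ G) (v : V) : nb H v ⊆ nb G v := by
  intro w hw
  rw [mem_nb] at hw ⊢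
  exact hle hw

lemma Good.mono {H : SimpleGraph V} (hG : Good Δ G) (hle : H ≤ G) : Good Δ H where
  P1 A := le_trans (Finset.sum_le_sum fun v _ =>
    Finset.card_le_card (Finset.filter_subset_filter _ (nb_mono hle v))) (hG.P1 A)
  P2 v := (Finset.card_le_card (nb_mono hle v)).trans (hG.P2 v)
  P3 := fun ⟨H', h1, h2⟩ => hG.P3 ⟨H', h1.trans hle, h2⟩

/-- induction hypothesis -/
def IH (Δ : ℕ) (G : SimpleGraph V) : Prop :=
  ∀ H : SimpleGraph V, Good Δ H → H.edgeSet.ncard < G.edgeSet.ncard → HasStrongColoring H (3 * Δ)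

lemma delEdge (hG : Good Δ G) (ih : IH Δ G) (h : Crit Δ G K) {p q : V} (a : G.Adj p q)
    (hk : s(p, q) ∉ K)
    (hc : ∀ e ∈ K, ∀ e' ∈ K, e ≠ e' → p ∈ e → q ∈ e' →
      ∃ r, r ∈ e ∧ r ∈ e') : False := by
  obtain ⟨C, hC⟩ := ih (G.deleteEdges {s(p, q)}) (hG.mono (G.deleteEdges_le _)) (by
    apply Set.ncard_lt_ncard _ (Set.toFinite _)
    rw [SimpleGraph.edgeSet_deleteEdges]
    refine ⟨Set.sdiff_subset, fun hs => ?_⟩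
    have := hs (show s(p, q) ∈ G.edgeSet from a)
    simp at this)
  apply h.no C
  have hKH : ∀ e ∈ K, e ∈ (G.deleteEdges {s(p, q)}).edgeSet := by
    intro e he
    rw [SimpleGraph.edgeSet_deleteEdges]
    exact ⟨h.KE e he, by rintro rfl; exact hk he⟩
  intro e he e' he' hcf
  apply hC e (hKH e he) e' (hKH e' he')
  rw [conflict_iff] at hcf ⊢
  obtain ⟨hne, x, hx, y, hy, hxy⟩ := hcf
  refine ⟨hne, ?_⟩
  rcases hxy with hxy | hxy
  · exact ⟨x, hx, y, hy, Or.inl hxy⟩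
  by_cases hs : s(x, y) = s(p, q)
  · rw [Sym2.eq_iff] at hs
    rcases hs with ⟨rfl, rfl⟩ | ⟨rfl, rfl⟩
    · obtain ⟨r, h1, h2⟩ := hc e he e' he' hne hx hy
      exact ⟨r, h1, r, h2, Or.inl rfl⟩
    · obtain ⟨r, h1, h2⟩ := hc e' he' e he hne.symm hy hx
      exact ⟨r, h2, r, h1, Or.inl rfl⟩
  · refine ⟨x, hx, y, hy, Or.inr ?_⟩
    rw [SimpleGraph.deleteEdges_adj]
    exact ⟨hxy, hs⟩

lemma crit_F2 (hG : Good Δ G) (ih : IH Δ G) (h : Crit Δ G K) (u w : V) (a : G.Adj u w) :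
    1 ≤ cl G K u := by
  by_contra hc
  have hno : ∀ e ∈ K, u ∉ e := fun e he hu => hc (cl_pos_of h.KE he hu)
  exact delEdge hG ih h a (fun hk => hno _ hk (by simp)) fun e he _ _ _ hu _ => (hno e he hu).elim

lemma crit_ctx (hD : 7 ≤ Δ) (hG : Good Δ G) (ih : IH Δ G) (h : Crit Δ G K) : Ctx Δ G K :=
  ⟨hD, hG.P2, crit_F1 h, crit_F2 hG ih h⟩

lemma ext2 {k : ℕ} {C : Sym2 V → Fin k} {e1 e2 : Sym2 V} (h12 : e1 ≠ e2)
    (hC : ∀ e ∈ K, ∀ e' ∈ K, e ≠ e1 → e ≠ e2 → e' ≠ e1 → e' ≠ e2 → Conflict G e e' → C e ≠ C e')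
    {c1 c2 : Fin k} (hc : c1 ≠ c2)
    (h1 : ∀ e ∈ K, e ≠ e1 → e ≠ e2 → Conflict G e1 e → C e ≠ c1)
    (h2 : ∀ e ∈ K, e ≠ e1 → e ≠ e2 → Conflict G e2 e → C e ≠ c2) :
    Pr G K (Function.update (Function.update C e1 c1) e2 c2) := by
  set D := Function.update (Function.update C e1 c1) e2 c2 with hD
  have d2 : D e2 = c2 := by simp [hD]
  have d1 : D e1 = c1 := by simp [hD, h12]
  have d0 : ∀ e, e ≠ e1 → e ≠ e2 → D e = C e := by
    intro e a b; simp [hD, a, b]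
  intro e he e' he' hcf
  have hne := hcf.1
  have hsy := conflict_symm hcf
  by_cases a1 : e = e1
  · subst a1
    rw [d1]
    by_cases b2 : e' = e2
    · subst b2; rw [d2]; exact hc
    · rw [d0 e' hne.symm b2]; exact (h1 e' he' hne.symm b2 hcf).symm
  by_cases a2 : e = e2
  · subst a2
    rw [d2]
    by_cases b2 : e' = e1
    · subst b2; rw [d1]; exact hc.symm
    · rw [d0 e' b2 hne.symm]; exact (h2 e' he' b2 hne.symm hcf).symm
  rw [d0 e a1 a2]
  by_cases b1 : e' = e1
  · subst b1; rw [d1]; exact h1 e he a1 a2 hsy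
  by_cases b2 : e' = e2
  · subst b2; rw [d2]; exact h2 e he a1 a2 hsy
  rw [d0 e' b1 b2]
  exact hC e he e' he' a1 a2 b1 b2 hcf

/-- Facts about a degree-two vertex `v` with degree-two neighbour `x`. -/
lemma pair_facts (h : Crit Δ G K) (hx : Ctx Δ G K) {w v x : V} (aw : G.Adj w v)
    (ax : G.Adj v x) (hv : dg G v = 2) (hx2 : dg G x = 2) (hwx : w ≠ x) :
    s(v, x) ∉ K ∧ s(w, v) ∈ K ∧ cl G K v = 1 ∧ nb G v = {x, w} ∧ (∀ e ∈ K, v ∈ e → e = s(w, v)) ∧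
    ∃ z, z ≠ v ∧ G.Adj x z ∧ nb G x = {v, z} ∧ 4 ≤ dd G z ∧ s(x, z) ∈ K ∧
      ∀ e ∈ K, x ∈ e → e = s(x, z) := by
  have h1 := TwoTwo hx ax hv hx2
  obtain ⟨h2, h3, _, _⟩ := TT hx ax hv hx2 aw.symm hwx
  obtain ⟨z, hz, az, e⟩ := two_nb ax.symm hx2
  obtain ⟨h4, h5, _, h6⟩ := TT hx ax.symm hx2 hv az hz
  have e' := two_nb' ax aw.symm hwx hv
  refine ⟨h1, by rwa [Sym2.eq_swap], h2, e', ?_, z, hz, az, e, h6, h5, ?_⟩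
  · intro e0 he0 hve
    obtain ⟨t, rfl⟩ := Sym2.mem_iff_exists.1 hve
    have : t ∈ nb G v := mem_nb.2 (h.KE _ he0)
    rw [e'] at this
    simp at this
    rcases this with rfl | rfl
    · exact absurd he0 h1
    · exact Sym2.eq_swap
  · intro e0 he0 hve
    obtain ⟨t, rfl⟩ := Sym2.mem_iff_exists.1 hve
    have : t ∈ nb G x := mem_nb.2 (h.KE _ he0)
    rw [e] at this
    simp at this
    rcases this with rfl | rfl
    · rw [Sym2.eq_swap] at he0
      exact absurd he0 h1
    · rfl

end

section
variable {V : Type} [Fintype V]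
variable {G : SimpleGraph V} {K : Finset (Sym2 V)} {Δ : ℕ}

/-- delete `v1x1`, `v2x2`, add `x1x2` -/
def swapG (G : SimpleGraph V) (v1 x1 v2 x2 : V) (hne : x1 ≠ x2) : SimpleGraph V where
  Adj a b := (G.Adj a b ∧ s(a, b) ≠ s(v1, x1) ∧ s(a, b) ≠ s(v2, x2)) ∨ s(a, b) = s(x1, x2)
  symm := ⟨fun a b hab => by rw [Sym2.eq_swap, G.adj_comm]; exact hab⟩
  loopless := ⟨fun a ha => by
    rcases ha with ha | ha
    · exact G.loopless.irrefl a ha.1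
    · rw [Sym2.eq_iff] at ha
      rcases ha with ⟨rfl, h⟩ | ⟨rfl, h⟩
      · exact hne h
      · exact hne h.symm⟩

lemma swapG_adj {v1 x1 v2 x2 a b : V} {hne : x1 ≠ x2} : (swapG G v1 x1 v2 x2 hne).Adj a b ↔
    (G.Adj a b ∧ s(a, b) ≠ s(v1, x1) ∧ s(a, b) ≠ s(v2, x2)) ∨ s(a, b) = s(x1, x2) := Iff.rfl

lemma swap_nb_x {v1 x1 v2 x2 z1 : V} {hne : x1 ≠ x2} (e1 : nb G x1 = {v1, z1}) :
    nb (swapG G v1 x1 v2 x2 hne) x1 ⊆ {z1, x2} := by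
  intro t ht
  rw [mem_nb, swapG_adj] at ht
  rw [Finset.mem_insert, Finset.mem_singleton]
  rcases ht with ⟨a, b, _⟩ | ht
  · have := mem_nb.2 a
    rw [e1, Finset.mem_insert, Finset.mem_singleton] at this
    rcases this with rfl | h
    · exact absurd Sym2.eq_swap b
    · exact Or.inl h
  · rw [Sym2.eq_iff] at ht
    rcases ht with ⟨_, h⟩ | ⟨h, _⟩
    · exact Or.inr h
    · exact absurd h hne

lemma swap_nb_x' {v1 x1 v2 x2 z2 : V} {hne : x1 ≠ x2} (e2 : nb G x2 = {v2, z2}) :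
    nb (swapG G v1 x1 v2 x2 hne) x2 ⊆ {z2, x1} := by
  intro t ht
  rw [mem_nb, swapG_adj] at ht
  rw [Finset.mem_insert, Finset.mem_singleton]
  rcases ht with ⟨a, _, b⟩ | ht
  · have := mem_nb.2 a
    rw [e2, Finset.mem_insert, Finset.mem_singleton] at this
    rcases this with rfl | h
    · exact absurd Sym2.eq_swap b
    · exact Or.inl h
  · rw [Sym2.eq_iff] at ht
    rcases ht with ⟨h, _⟩ | ⟨_, h⟩
    · exact absurd h.symm hne
    · exact Or.inr h

lemma swap_good (hD : 7 ≤ Δ) (hG : Good Δ G) {v1 x1 v2 x2 z1 z2 : V} (hne : x1 ≠ x2)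
    (e1 : nb G x1 = {v1, z1}) (e2 : nb G x2 = {v2, z2}) :
    Good Δ (swapG G v1 x1 v2 x2 hne) := by
  set H := swapG G v1 x1 v2 x2 hne with hH
  have n1 : nb H x1 ⊆ {z1, x2} := swap_nb_x e1
  have n2 : nb H x2 ⊆ {z2, x1} := swap_nb_x' e2
  have adj0 : ∀ {a b}, H.Adj a b → G.Adj a b ∨ (a = x1 ∧ b = x2) ∨ (a = x2 ∧ b = x1) := by
    intro a b hab
    rcases hab with h | h
    · exact Or.inl h.1
    · rw [Sym2.eq_iff] at h; exact Or.inr h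
  refine ⟨fun A => ?_, fun v => ?_, ?_⟩
  · by_cases hx : x1 ∈ A ∧ x2 ∈ A
    swap
    · refine le_trans (Finset.sum_le_sum fun v hv => Finset.card_le_card ?_) (hG.P1 A)
      intro t ht
      rw [Finset.mem_filter, mem_nb] at ht ⊢
      refine ⟨?_, ht.2⟩
      rcases adj0 ht.1 with h | ⟨rfl, rfl⟩ | ⟨rfl, rfl⟩
      · exact h
      · exact absurd ⟨hv, ht.2⟩ hx
      · exact absurd ⟨ht.2, hv⟩ hx
    · obtain ⟨m1, m2⟩ := hx
      have m2' : x2 ∈ A.erase x1 := Finset.mem_erase.2 ⟨hne.symm, m2⟩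
      set B := (A.erase x1).erase x2 with hB
      have hcard : A.card = B.card + 2 := by
        have h1 := Finset.card_erase_add_one m1
        have h2 : B.card + 1 = (A.erase x1).card := Finset.card_erase_add_one m2'
        omega
      rw [← Finset.add_sum_erase _ _ m1, ← Finset.add_sum_erase _ _ m2', ← hB]
      have c1 : ((nb H x1).filter (· ∈ A)).card ≤ 2 :=
        (Finset.card_filter_le _ _).trans ((Finset.card_le_card n1).trans Finset.card_le_two)
      have c2 : ((nb H x2).filter (· ∈ A)).card ≤ 2 :=
        (Finset.card_filter_le _ _).trans ((Finset.card_le_card n2).trans Finset.card_le_two)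
      have c3 : ∑ v ∈ B, ((nb H v).filter (· ∈ A)).card ≤
          ∑ v ∈ B, (((nb G v).filter (· ∈ B)).card +
            ((if v = z1 then 1 else 0) + (if v = z2 then 1 else 0))) := by
        refine Finset.sum_le_sum fun v hv => ?_
        rw [hB, Finset.mem_erase, Finset.mem_erase] at hv
        have hsub : (nb H v).filter (· ∈ A) ⊆ (nb G v).filter (· ∈ B) ∪
            ((if v = z1 then {x1} else ∅) ∪ (if v = z2 then {x2} else ∅)) := by
          intro t ht
          rw [Finset.mem_filter, mem_nb] at ht
          rw [Finset.mem_union, Finset.mem_union]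
          by_cases t1 : t = x1
          · right; left
            subst t1
            have h1 := n1 (mem_nb.2 ht.1.symm)
            rw [Finset.mem_insert, Finset.mem_singleton] at h1
            rcases h1 with h1 | h1
            · simp [h1]
            · exact absurd h1 hv.1
          by_cases t2 : t = x2
          · right; right
            subst t2
            have h1 := n2 (mem_nb.2 ht.1.symm)
            rw [Finset.mem_insert, Finset.mem_singleton] at h1
            rcases h1 with h1 | h1
            · simp [h1]
            · exact absurd h1 hv.2.1
          left
          rw [Finset.mem_filter, mem_nb, hB, Finset.mem_erase, Finset.mem_erase]
          refine ⟨?_, t2, t1, ht.2⟩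
          rcases adj0 ht.1 with h | ⟨_, h⟩ | ⟨_, h⟩
          · exact h
          · exact absurd h t2
          · exact absurd h t1
        refine (Finset.card_le_card hsub).trans ((Finset.card_union_le _ _).trans ?_)
        refine Nat.add_le_add_left ((Finset.card_union_le _ _).trans ?_) _
        apply Nat.add_le_add <;> split_ifs <;> simp
      rw [Finset.sum_add_distrib, Finset.sum_add_distrib, Finset.sum_ite_eq', Finset.sum_ite_eq']
        at c3
      have h5 := hG.P1 B
      split_ifs at c3 <;> omega
  · by_cases h1 : v = x1
    · rw [h1]
      have : dg H x1 ≤ 2 := (Finset.card_le_card n1).trans Finset.card_le_two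
      omega
    by_cases h2 : v = x2
    · rw [h2]
      have : dg H x2 ≤ 2 := (Finset.card_le_card n2).trans Finset.card_le_two
      omega
    refine le_trans (Finset.card_le_card ?_) (hG.P2 v)
    intro t ht
    rw [mem_nb] at ht ⊢
    rcases adj0 ht with h | ⟨h, _⟩ | ⟨h, _⟩
    · exact h
    · exact absurd h h1
    · exact absurd h h2
  · rintro ⟨H', hle, hsup, hreg⟩
    have key : ∀ x, dg H x ≤ 2 → x ∉ H'.support := by
      intro x hx hs
      have h3 := hreg x hs
      have : (H'.neighborSet x).ncard ≤ (nb H x).card := by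
        rw [← Set.ncard_coe_finset]
        apply Set.ncard_le_ncard _ (Set.toFinite _)
        intro t ht
        exact mem_nb.2 (hle ht)
      unfold dg at hx
      omega
    have k1 := key x1 ((Finset.card_le_card n1).trans Finset.card_le_two)
    have k2 := key x2 ((Finset.card_le_card n2).trans Finset.card_le_two)
    refine hG.P3 ⟨H', ?_, hsup, hreg⟩
    intro a b hab
    rcases adj0 (hle hab) with h | ⟨rfl, rfl⟩ | ⟨rfl, rfl⟩
    · exact h
    · exact absurd ⟨_, hab⟩ k1
    · exact absurd ⟨_, hab⟩ k2

lemma swap_edges {v1 x1 v2 x2 : V} (hne : x1 ≠ x2) (a1 : G.Adj v1 x1) (a2 : G.Adj v2 x2)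
    (hs : s(v1, x1) ≠ s(v2, x2)) :
    (swapG G v1 x1 v2 x2 hne).edgeSet.ncard < G.edgeSet.ncard := by
  have h1 : (swapG G v1 x1 v2 x2 hne).edgeSet ⊆
      insert s(x1, x2) ((G.edgeSet \ {s(v1, x1)}) \ {s(v2, x2)}) := by
    intro e
    induction e with
    | _ a b =>
      intro h
      rcases h with h | h
      · right; exact ⟨⟨h.1, h.2.1⟩, h.2.2⟩
      · left; exact h
  have h2 := Set.ncard_le_ncard h1 (Set.toFinite _)
  have h3 := Set.ncard_insert_le s(x1, x2) ((G.edgeSet \ {s(v1, x1)}) \ {s(v2, x2)})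
  have h4 := Set.ncard_sdiff_singleton_add_one (s := G.edgeSet) (a := s(v1, x1)) a1 (Set.toFinite _)
  have h5 := Set.ncard_sdiff_singleton_add_one (s := G.edgeSet \ {s(v1, x1)}) (a := s(v2, x2))
    ⟨a2, hs.symm⟩ (Set.toFinite _)
  omega

lemma choose_colors {k : ℕ} (hk : 2 ≤ k) (S : Finset (Fin k)) (hS : S.card + 2 ≤ k) {a b : Fin k}
    (hab : a ≠ b) : ∃ c1 c2, c1 ≠ c2 ∧ c1 ∉ S ∧ c1 ≠ a ∧ c2 ∉ S ∧ c2 ≠ b := by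
  have h1 : ∃ c1, c1 ∉ S ∧ c1 ≠ a ∧ (insert c1 (insert b S)).card < k := by
    by_cases hb : b ∈ S
    · obtain ⟨c1, hc⟩ := exists_color (insert a S)
        (lt_of_le_of_lt (Finset.card_insert_le _ _) (by omega))
      rw [Finset.mem_insert] at hc
      push Not at hc
      refine ⟨c1, hc.2, hc.1, ?_⟩
      rw [Finset.insert_eq_of_mem hb]
      exact lt_of_le_of_lt (Finset.card_insert_le _ _) (by omega)
    · refine ⟨b, hb, hab.symm, ?_⟩
      rw [Finset.insert_eq_of_mem (Finset.mem_insert_self _ _)]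
      exact lt_of_le_of_lt (Finset.card_insert_le _ _) (by omega)
  obtain ⟨c1, h2, h3, h4⟩ := h1
  obtain ⟨c2, hc⟩ := exists_color _ h4
  simp only [Finset.mem_insert] at hc
  push Not at hc
  exact ⟨c1, c2, hc.1.symm, h2, h3, hc.2.2, hc.2.1⟩

lemma crit_PL (hD : 7 ≤ Δ) (hG : Good Δ G) (ih : IH Δ G) (h : Crit Δ G K) : PLh Δ G K := by
  have hx := crit_ctx hD hG ih h
  rintro w v1 v2 hv aw1 aw2 d1 d2 ⟨x1, ax1, dx1⟩ ⟨x2, ax2, dx2⟩ hX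
  have hw2 : dg G w ≠ 2 := by
    intro hw
    obtain ⟨y, hy, _, e⟩ := two_nb aw1 hw
    rw [XX_two hy e] at hX
    have := cl_le hx v1
    have := cl_le hx y
    omega
  have hwx1 : w ≠ x1 := by rintro rfl; exact hw2 dx1
  have hwx2 : w ≠ x2 := by rintro rfl; exact hw2 dx2
  obtain ⟨nK1, wK1, c1, ev1, uv1, z1, hz1, az1, ex1, dz1, zK1, ux1⟩ :=
    pair_facts h hx aw1 ax1 d1 dx1 hwx1
  obtain ⟨nK2, wK2, c2, ev2, uv2, z2, hz2, az2, ex2, dz2, zK2, ux2⟩ :=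
    pair_facts h hx aw2 ax2 d2 dx2 hwx2
  have hdz1 := dd_le_dg (G := G) z1
  have hdz2 := dd_le_dg (G := G) z2
  by_cases htri : x1 = v2
  · subst htri
    refine delEdge hG ih h ax1 nK1 ?_
    intro e he e' he' _ h1 h2
    refine ⟨w, ?_, ?_⟩
    · rw [uv1 e he h1]; simp
    · rw [uv2 e' he' h2]; simp
  have htri2 : x2 ≠ v1 := by
    rintro rfl
    have : v2 ∈ nb G x2 := mem_nb.2 ax2.symm
    rw [ev1] at this
    simp at this
    rcases this with h1 | h1
    · exact htri h1.symm
    · exact aw2.ne h1.symm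
  have hxx : x1 ≠ x2 := by
    rintro rfl
    have : v2 ∈ nb G x1 := mem_nb.2 ax2.symm
    rw [ex1] at this
    simp at this
    rcases this with h1 | h1
    · exact hv h1.symm
    · subst h1; omega
  have hss : s(v1, x1) ≠ s(v2, x2) := by
    intro e
    rw [Sym2.eq_iff] at e
    rcases e with ⟨e, _⟩ | ⟨e, _⟩
    · exact hv e
    · exact htri2 e.symm
  obtain ⟨C, hC⟩ := ih _ (swap_good hD hG hxx ex1 ex2) (swap_edges hxx ax1 ax2 hss)
  have KH : ∀ e ∈ K, e ∈ (swapG G v1 x1 v2 x2 hxx).edgeSet := by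
    intro e he
    have hE := h.KE e he
    induction e with
    | _ a b =>
      left
      exact ⟨hE, fun h1 => nK1 (h1 ▸ he), fun h1 => nK2 (h1 ▸ he)⟩
  have hab : C s(x1, z1) ≠ C s(x2, z2) := by
    apply hC _ (KH _ zK1) _ (KH _ zK2)
    rw [conflict_iff]
    refine ⟨?_, x1, by simp, x2, by simp, Or.inr (Or.inr rfl)⟩
    intro e
    rw [Sym2.eq_iff] at e
    rcases e with ⟨e, _⟩ | ⟨e, _⟩
    · exact hxx e
    · subst e; omega
  have hCK : ∀ e ∈ K, ∀ e' ∈ K, e ≠ s(w, v1) → e ≠ s(w, v2) → e' ≠ s(w, v1) → e' ≠ s(w, v2) →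
      Conflict G e e' → C e ≠ C e' := by
    intro e he e' he' n1 n2 n1' n2' hcf
    apply hC e (KH e he) e' (KH e' he')
    rw [conflict_iff] at hcf ⊢
    obtain ⟨hne, p, hp, q, hq, hpq⟩ := hcf
    refine ⟨hne, p, hp, q, hq, ?_⟩
    rcases hpq with hpq | hpq
    · exact Or.inl hpq
    right; left
    refine ⟨hpq, fun e0 => ?_, fun e0 => ?_⟩
    · rw [Sym2.eq_iff] at e0
      rcases e0 with ⟨rfl, _⟩ | ⟨_, rfl⟩
      · exact n1 (uv1 e he hp)
      · exact n1' (uv1 e' he' hq)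
    · rw [Sym2.eq_iff] at e0
      rcases e0 with ⟨rfl, _⟩ | ⟨_, rfl⟩
      · exact n2 (uv2 e he hp)
      · exact n2' (uv2 e' he' hq)
  -- the remaining K-edges near w
  set N := ((nb G w).erase v1).erase v2 with hN
  have m1 : v1 ∈ nb G w := mem_nb.2 aw1
  have m2 : v2 ∈ (nb G w).erase v1 := Finset.mem_erase.2 ⟨hv.symm, mem_nb.2 aw2⟩
  have hNc : (N.biUnion (Kat G K)).card + 2 ≤ 3 * Δ := by
    have h1 : (N.biUnion (Kat G K)).card ≤ ∑ u ∈ N, cl G K u :=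
      Finset.card_biUnion_le.trans (Finset.sum_le_sum fun u _ => Kat_card u)
    have h2 : XX G K w = cl G K v1 + (cl G K v2 + ∑ u ∈ N, cl G K u) := by
      rw [XX, ← Finset.add_sum_erase _ _ m1, ← Finset.add_sum_erase _ _ m2]
    omega
  obtain ⟨k1, k2, hk, hk1, hk1', hk2, hk2'⟩ := choose_colors (k := 3 * Δ) (by omega)
    ((N.biUnion (Kat G K)).image C)
    (le_trans (Nat.add_le_add_right Finset.card_image_le _) hNc) hab
  have hNmem : ∀ e ∈ K, ∀ q ∈ e, G.Adj w q → q ≠ v1 → q ≠ v2 →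
      C e ∈ (N.biUnion (Kat G K)).image C := by
    intro e he q hq aq n1 n2
    refine Finset.mem_image_of_mem _ (Finset.mem_biUnion.2 ⟨q, ?_, mem_Kat h.KE he hq⟩)
    rw [hN, Finset.mem_erase, Finset.mem_erase]
    exact ⟨n2, n1, mem_nb.2 aq⟩
  refine h.no _ (ext2 (e1 := s(w, v1)) (e2 := s(w, v2)) (C := C) ?_ hCK hk ?_ ?_)
  · intro e
    rw [Sym2.eq_iff] at e
    rcases e with ⟨_, e⟩ | ⟨e, _⟩
    · exact hv e
    · exact aw2.ne e
  · intro e he n1 n2 hcf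
    obtain ⟨q, hq, hq' | hq'⟩ := conf_edge (h.KE e he) hcf
    · by_cases hq2 : q = v2
      · subst hq2; exact absurd (uv2 e he hq) n2
      · intro e0
        exact hk1 (e0 ▸ hNmem e he q hq hq'.1 hq'.2 hq2)
    · have : q ∈ nb G v1 := mem_nb.2 hq'.1
      rw [ev1] at this
      simp at this
      rcases this with rfl | rfl
      · rw [ux1 e he hq]; exact hk1'.symm
      · exact absurd rfl hq'.2
  · intro e he n1 n2 hcf
    obtain ⟨q, hq, hq' | hq'⟩ := conf_edge (h.KE e he) hcf
    · by_cases hq2 : q = v1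
      · subst hq2; exact absurd (uv1 e he hq) n1
      · intro e0
        exact hk2 (e0 ▸ hNmem e he q hq hq'.1 hq2 hq'.2)
    · have : q ∈ nb G v2 := mem_nb.2 hq'.1
      rw [ev2] at this
      simp at this
      rcases this with rfl | rfl
      · rw [ux2 e he hq]; exact hk2'.symm
      · exact absurd rfl hq'.2

theorem good_colorable (hD : 7 ≤ Δ) : ∀ (n : ℕ) (G : SimpleGraph V), G.edgeSet.ncard = n →
    Good Δ G → HasStrongColoring G (3 * Δ) := by
  intro n
  induction n using Nat.strong_induction_on with
  | _ n ihn =>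
    intro G hn hG
    have ih : IH Δ G := fun H hH hlt => ihn _ (hn ▸ hlt) H rfl hH
    by_contra hno
    obtain ⟨K, hK⟩ := exists_crit hno
    have hne : K.Nonempty := by
      rw [Finset.nonempty_iff_ne_empty]
      rintro rfl
      exact hK.no (fun _ => ⟨0, by omega⟩) (fun e he => by simp at he)
    obtain ⟨e, he⟩ := hne
    have hE := hK.KE e he
    induction e with
    | _ u v =>
      exact comb (crit_ctx hD hG ih hK) (crit_PL hD hG ih hK) hG.P1 hG.P3 he hE

lemma dg_eq_degree (G : SimpleGraph V) (v : V) : dg G v = G.degree v := by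
  rw [← SimpleGraph.card_neighborFinset_eq_degree, dg]
  congr 1
  ext w
  simp [mem_nb]

lemma mad_sum (G : SimpleGraph V) (h : mad G ≤ 3) (A : Finset V) :
    ∑ v ∈ A, ((nb G v).filter (· ∈ A)).card ≤ 3 * A.card := by
  by_cases hA : A.Nonempty
  swap
  · rw [Finset.not_nonempty_iff_eq_empty] at hA; subst hA; simp
  have h1 : 2 * ({e ∈ G.edgeSet | ∀ v ∈ e, v ∈ A}.ncard : ℝ) / (A.card : ℝ) ≤ 3 := by
    have hm : 2 * ({e ∈ G.edgeSet | ∀ v ∈ e, v ∈ A}.ncard : ℝ) / (A.card : ℝ) ∈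
        {x : ℝ | ∃ A : Finset V, A.Nonempty ∧
          x = 2 * ({e ∈ G.edgeSet | ∀ v ∈ e, v ∈ A}.ncard : ℝ) / (A.card : ℝ)} := ⟨A, hA, rfl⟩
    unfold mad at h
    refine le_trans (le_csSup ?_ hm) h
    apply Set.Finite.bddAbove
    refine Set.Finite.subset (Set.finite_range (fun A : Finset V =>
      2 * ({e ∈ G.edgeSet | ∀ v ∈ e, v ∈ A}.ncard : ℝ) / (A.card : ℝ))) ?_
    rintro x ⟨B, _, rfl⟩
    exact ⟨B, rfl⟩
  have hpos : (0 : ℝ) < A.card := by exact_mod_cast hA.card_pos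
  rw [div_le_iff₀ hpos] at h1
  have h2 : 2 * {e ∈ G.edgeSet | ∀ v ∈ e, v ∈ A}.ncard ≤ 3 * A.card := by exact_mod_cast h1
  let H : SimpleGraph V :=
    { Adj := fun x y => G.Adj x y ∧ x ∈ A ∧ y ∈ A
      symm := ⟨fun x y hxy => ⟨hxy.1.symm, hxy.2.2, hxy.2.1⟩⟩
      loopless := ⟨fun x hx => G.loopless.irrefl x hx.1⟩ }
  have hH : ∀ x y, H.Adj x y ↔ G.Adj x y ∧ x ∈ A ∧ y ∈ A := fun _ _ => Iff.rfl
  have h3 := H.sum_degrees_eq_twice_card_edges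
  have h4 : H.edgeFinset.card = {e ∈ G.edgeSet | ∀ v ∈ e, v ∈ A}.ncard := by
    rw [← Set.ncard_coe_finset, SimpleGraph.coe_edgeFinset]
    congr 1
    ext e
    induction e with
    | _ a b => simp [hH]
  have h5 : ∑ v ∈ A, ((nb G v).filter (· ∈ A)).card ≤ ∑ v, H.degree v := by
    refine le_trans (Finset.sum_le_sum fun v hv => ?_)
      (Finset.sum_le_sum_of_subset (Finset.subset_univ A))
    have hdeg : dg H v = H.degree v := by
      rw [← SimpleGraph.card_neighborFinset_eq_degree, dg]
      congr 1
      ext w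
      simp [mem_nb]
    rw [← hdeg]
    apply Finset.card_le_card
    intro t ht
    rw [Finset.mem_filter, mem_nb] at ht
    exact mem_nb.2 ⟨ht.1, hv, ht.2⟩
  omega

lemma GoodB.good {G : SimpleGraph V} (h : GoodB Δ G) : Good Δ G where
  P1 := mad_sum G h.1
  P2 v := by rw [dg_eq_degree]; exact (G.degree_le_maxDegree v).trans h.2.1
  P3 := h.2.2

end

/-- Basic structure of a minimal counterexample `G` to `χ'_s ≤ 3Δ` for graphs with
`Mad ≤ 3`, maximum degree at most `Δ ≥ 7` and no 3-regular subgraph: for every vertex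
`v` of `G*`, (i) if the degrees in `G` of the `G*`-neighbors of `v` sum to at most
`2Δ + d_{G*}(v)` then `d_G(v) = d_{G*}(v)`; (ii) `d_{G*}(v) ≥ 2`; (iii) if
`d_{G*}(v) = 2` then `d_G(v) = 2`; (iv) if `d_{G*}(v) = 3` and `v` has a `G*`-neighbor
`u` with `d_G(u) ≤ 3`, then `d_G(v) = 3`. -/
theorem minCexB_basic_structure (Δ : ℕ) (hΔ : 7 ≤ Δ) {V : Type} [Fintype V]
    (G : SimpleGraph V) (hG : MinCexB Δ G) :
    ∀ v : V, G.degree v ≠ 1 →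
      ((∑ u ∈ (core G).neighborFinset v, G.degree u ≤ 2 * Δ + (core G).degree v →
          G.degree v = (core G).degree v) ∧
        2 ≤ (core G).degree v ∧
        ((core G).degree v = 2 → G.degree v = 2) ∧
        ((core G).degree v = 3 → (∃ u, (core G).Adj v u ∧ G.degree u ≤ 3) →
          G.degree v = 3)) := by
  intro v _
  exact (hG.2.1 (good_colorable hΔ _ G rfl hG.1.good)).elim

end StrongEC
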